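/- Let u be an admissible solution of the vorticity equation on [0,T) with viscosity ν > 0, and let E(t) = (1/2)‖ω(t,·)‖²_{L²(ℝ³)} be the enstrophy. Then for every t ∈ [0,T), the function E is differentiable at t with derivative E'(t) satisfying E'(t) ≤ E(t)³/(3456 π⁴ ν³). -/

import Mathlib

open MeasureTheory Real SchwartzMap
open scoped FourierTransform ENNReal

noncomputable section

/-- Euclidean three-space. -/
abbrev E3 : Type := EuclideanSpace ℝ (Fin 3)

/-- The `i`-th standard basis vector. -/
def ee (i : Fin 3) : E3 := EuclideanSpace.single i 1

/-- The partial derivative `∂ᵢ f`. -/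
def pd (i : Fin 3) (f : E3 → ℝ) : E3 → ℝ := fun x => fderiv ℝ f x (ee i)

/-- The Fourier transform (kernel `e^{-2πi x·ξ}`) of a real-valued function. -/
def ft (f : E3 → ℝ) : E3 → ℂ := 𝓕 (fun x => (f x : ℂ))

/-- The squared homogeneous Sobolev norm `‖v‖²_{Ḣ^s}` of a vector field. -/
def hsV (s : ℝ) (v : Fin 3 → E3 → ℝ) : ℝ :=
  ∫ ξ : E3, (2 * π * ‖ξ‖) ^ (2 * s) * ∑ i, ‖ft (v i) ξ‖ ^ 2

/-- The curl `ω = ∇ × u` of a vector field. -/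
def curl (u : Fin 3 → E3 → ℝ) : Fin 3 → E3 → ℝ :=
  ![fun x => pd 1 (u 2) x - pd 2 (u 1) x,
    fun x => pd 2 (u 0) x - pd 0 (u 2) x,
    fun x => pd 0 (u 1) x - pd 1 (u 0) x]

/-- The strain tensor `S = (∇u + (∇u)ᵀ)/2`. -/
def strain (u : Fin 3 → E3 → ℝ) : Fin 3 → Fin 3 → E3 → ℝ :=
  fun i j x => (pd i (u j) x + pd j (u i) x) / 2

/-- The time interval `[0,T)` for `T ∈ (0,∞]`. -/
def timeSet (T : ℝ≥0∞) : Set ℝ := {t : ℝ | 0 ≤ t ∧ ENNReal.ofReal t < T}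

/-- An admissible solution of the vorticity equation on `[0,T)` with viscosity `ν`:
`u` is jointly smooth, Schwartz in space at each time with time-locally uniform
Schwartz seminorm bounds (also for `∂ₜu`), divergence free, and its vorticity
`ω = ∇×u` satisfies `∂ₜω − νΔω + (u·∇)ω − Sω = 0` on `[0,T) × ℝ³`. -/
structure AdmissibleSolution (ν : ℝ) (T : ℝ≥0∞) where
  u : ℝ → Fin 3 → 𝓢(E3, ℝ)
  u' : ℝ → Fin 3 → 𝓢(E3, ℝ)
  smooth : ∀ i : Fin 3,
    ContDiffOn ℝ (⊤ : ℕ∞) (fun p : ℝ × E3 => u p.1 i p.2) (timeSet T ×ˢ Set.univ)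
  tderiv : ∀ t ∈ timeSet T, ∀ i : Fin 3, ∀ x : E3,
    HasDerivWithinAt (fun s => u s i x) (u' t i x) (timeSet T) t
  seminorm_bdd : ∀ K : Set ℝ, IsCompact K → K ⊆ timeSet T → ∀ k n : ℕ, ∀ i : Fin 3,
    ∃ C : ℝ, ∀ t ∈ K, SchwartzMap.seminorm ℝ k n (u t i) ≤ C ∧
      SchwartzMap.seminorm ℝ k n (u' t i) ≤ C
  divfree : ∀ t ∈ timeSet T, ∀ x : E3, ∑ i, pd i (⇑(u t i)) x = 0
  vort_eq : ∀ t ∈ timeSet T, ∀ x : E3, ∀ k : Fin 3,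
    derivWithin (fun s => curl (fun i => ⇑(u s i)) k x) (timeSet T) t
      - ν * (∑ i, pd i (pd i (curl (fun i => ⇑(u t i)) k)) x)
      + (∑ i, u t i x * pd i (curl (fun i => ⇑(u t i)) k) x)
      - (∑ j, strain (fun i => ⇑(u t i)) k j x * curl (fun i => ⇑(u t i)) j x) = 0

/-- The vorticity of an admissible solution at time `t`. -/
def AdmissibleSolution.vort {ν : ℝ} {T : ℝ≥0∞} (sol : AdmissibleSolution ν T)
    (t : ℝ) : Fin 3 → E3 → ℝ :=
  curl (fun i => ⇑(sol.u t i))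

/-- The horizontal part `ω_h = (ω₁, ω₂, 0)` of the vorticity. -/
def AdmissibleSolution.vorth {ν : ℝ} {T : ℝ≥0∞} (sol : AdmissibleSolution ν T)
    (t : ℝ) : Fin 3 → E3 → ℝ :=
  ![sol.vort t 0, sol.vort t 1, fun _ => 0]

/-- The enstrophy `E(t) = (1/2)‖ω(t,·)‖²_{L²}`. -/
def AdmissibleSolution.enstrophy {ν : ℝ} {T : ℝ≥0∞} (sol : AdmissibleSolution ν T)
    (t : ℝ) : ℝ :=
  (1 / 2) * ∫ x : E3, ∑ k, (sol.vort t k x) ^ 2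

namespace GN

/-- cumulative integral -/
def cdf (ρ : ℝ → ℝ) (x : ℝ) : ℝ := ∫ t in Set.Iic x, ρ t

lemma cdf_hasDerivAt {ρ : ℝ → ℝ} (hc : Continuous ρ) (hi : Integrable ρ) (x : ℝ) :
    HasDerivAt (cdf ρ) (ρ x) x := by
  have h1 : cdf ρ = fun x => (∫ t in Set.Iic 0, ρ t) + ∫ t in (0:ℝ)..x, ρ t := by
    funext y
    have := intervalIntegral.integral_Iic_sub_Iic (μ := volume) (a := 0) (b := y)
      hi.integrableOn hi.integrableOn
    simp only [cdf]; linarith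
  rw [h1]
  exact (intervalIntegral.integral_hasDerivAt_right (hi.intervalIntegrable)
    hc.stronglyMeasurable.stronglyMeasurableAtFilter hc.continuousAt).const_add _

lemma cdf_tendsto_bot {ρ : ℝ → ℝ} (hi : Integrable ρ) :
    Filter.Tendsto (cdf ρ) Filter.atBot (nhds 0) :=
  tendsto_integral_Iic_zero Filter.tendsto_id

lemma cdf_tendsto_top {ρ : ℝ → ℝ} (hi : Integrable ρ) :
    Filter.Tendsto (cdf ρ) Filter.atTop (nhds (∫ t, ρ t)) := by
  have := tendsto_setIntegral_of_monotone (μ := volume) (f := ρ) (s := fun x : ℝ => Set.Iic x)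
    (fun _ => measurableSet_Iic) (fun a b h => Set.Iic_subset_Iic.2 h) hi.integrableOn
  rw [Set.iUnion_Iic] at this
  rw [Measure.restrict_univ] at this
  exact this

lemma cdf_nonneg {ρ : ℝ → ℝ} (h0 : ∀ x, 0 ≤ ρ x) (x : ℝ) : 0 ≤ cdf ρ x :=
  setIntegral_nonneg measurableSet_Iic fun _ _ => h0 _

lemma cdf_le {ρ : ℝ → ℝ} (h0 : ∀ x, 0 ≤ ρ x) (hi : Integrable ρ) (x : ℝ) :
    cdf ρ x ≤ ∫ t, ρ t :=
  setIntegral_le_integral hi (Filter.Eventually.of_forall h0)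

lemma cdf_continuous {ρ : ℝ → ℝ} (hc : Continuous ρ) (hi : Integrable ρ) : Continuous (cdf ρ) :=
  continuous_iff_continuousAt.2 fun x => (cdf_hasDerivAt hc hi x).continuousAt

lemma bdd_of_cont {ψ : ℝ → ℝ} (hψ : Continuous ψ) : ∃ C, 0 ≤ C ∧ ∀ u ∈ Set.Icc (0:ℝ) 1, |ψ u| ≤ C := by
  obtain ⟨C, hC⟩ := isCompact_Icc.exists_bound_of_continuousOn (hψ.continuousOn (s := Set.Icc (0:ℝ) 1))
  exact ⟨|C|, abs_nonneg _, fun u hu => (hC u hu).trans (le_abs_self _)⟩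

/-- substitution -/
lemma integral_cdf {ρ : ℝ → ℝ} (h0 : ∀ x, 0 ≤ ρ x) (hc : Continuous ρ) (hi : Integrable ρ)
    (h1 : ∫ t, ρ t ≤ 1) {ψ : ℝ → ℝ} (hψ : Continuous ψ) :
    ∫ x, ρ x * ψ (cdf ρ x) = ∫ u in (0:ℝ)..(∫ t, ρ t), ψ u := by
  obtain ⟨C, hC0, hC⟩ := bdd_of_cont hψ
  have hintg : Integrable (fun x => ρ x * ψ (cdf ρ x)) := by
    refine hi.mul_bdd (c := C) (hψ.comp (cdf_continuous hc hi)).aestronglyMeasurable ?_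
    exact Filter.Eventually.of_forall fun x =>
      hC _ ⟨cdf_nonneg h0 x, (cdf_le h0 hi x).trans h1⟩
  have hd : ∀ x, HasDerivAt (fun x => ∫ u in (0:ℝ)..(cdf ρ x), ψ u) (ρ x * ψ (cdf ρ x)) x := by
    intro x
    have := (intervalIntegral.integral_hasDerivAt_right (a := 0) (b := cdf ρ x)
      (hψ.intervalIntegrable _ _) hψ.stronglyMeasurable.stronglyMeasurableAtFilter
      hψ.continuousAt).comp x (cdf_hasDerivAt hc hi x)
    rw [mul_comm] at this
    exact this
  have hcont : Continuous fun y => ∫ u in (0:ℝ)..y, ψ u :=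
    intervalIntegral.continuous_primitive (fun _ _ => hψ.intervalIntegrable _ _) 0
  have := integral_of_hasDerivAt_of_tendsto hd hintg
    ((hcont.tendsto 0).comp (cdf_tendsto_bot hi)) ((hcont.tendsto _).comp (cdf_tendsto_top hi))
  simpa using this

/-- one dimensional integration by parts -/
lemma ibp_one {ρ h h' P P' : ℝ → ℝ} (h0 : ∀ x, 0 ≤ ρ x) (hc : Continuous ρ) (hi : Integrable ρ)
    (h1 : ∫ t, ρ t ≤ 1) (hP : ∀ u, HasDerivAt P (P' u) u) (hP' : Continuous P')
    (hh : ∀ x, HasDerivAt h (h' x) x) (hhi : Integrable h) (hhi' : Integrable h')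
    {b : ℝ} (hb : ∀ x, |h x| ≤ b) :
    ∫ x, h x * (P' (cdf ρ x) * ρ x) = - ∫ x, h' x * P (cdf ρ x) := by
  have hPc : Continuous P := continuous_iff_continuousAt.2 fun x => (hP x).continuousAt
  have hhc : Continuous h := continuous_iff_continuousAt.2 fun x => (hh x).continuousAt
  obtain ⟨C, hC0, hC⟩ := bdd_of_cont hPc
  obtain ⟨C', hC0', hC'⟩ := bdd_of_cont hP'
  have hm : ∀ x, cdf ρ x ∈ Set.Icc (0:ℝ) 1 := fun x => ⟨cdf_nonneg h0 x, (cdf_le h0 hi x).trans h1⟩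
  have hcc := cdf_continuous hc hi
  apply integral_mul_deriv_eq_deriv_mul_of_integrable (u := h) (v := fun x => P (cdf ρ x))
    (u' := h') (v' := fun x => P' (cdf ρ x) * ρ x)
  · intro x _; exact hh x
  · intro x _; exact (hP (cdf ρ x)).comp x (cdf_hasDerivAt hc hi x)
  · have := (hi.bdd_mul (c := b * C') (f := fun x => h x * P' (cdf ρ x))
      (hhc.mul (hP'.comp hcc)).aestronglyMeasurable (Filter.Eventually.of_forall fun x => by
        rw [Real.norm_eq_abs, abs_mul]
        exact mul_le_mul (hb x) (hC' _ (hm x)) (abs_nonneg _) ((abs_nonneg _).trans (hb x))))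
    convert this using 1
    funext x; simp only [Pi.mul_apply]; ring
  · exact hhi'.mul_bdd (c := C) (hPc.comp hcc).aestronglyMeasurable
      (Filter.Eventually.of_forall fun x => hC _ (hm x))
  · exact hhi.mul_bdd (c := C) (hPc.comp hcc).aestronglyMeasurable
      (Filter.Eventually.of_forall fun x => hC _ (hm x))

/-- Integration by parts with parameters. -/
lemma ibp_param {Y : Type*} [MeasurableSpace Y] {μ : Measure Y} [SFinite μ]
    {ρ h h' : ℝ → Y → ℝ} {P P' : ℝ → ℝ} {b : Y → ℝ}
    (h0 : ∀ x y, 0 ≤ ρ x y) (hc : ∀ y, Continuous fun x => ρ x y)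
    (hi : ∀ y, Integrable fun x => ρ x y)
    (h1 : ∀ y, ∫ t, ρ t y ≤ 1) (hP : ∀ u, HasDerivAt P (P' u) u) (hP' : Continuous P')
    (hh : ∀ x y, HasDerivAt (fun x => h x y) (h' x y) x)
    (hhi : ∀ y, Integrable (fun x => h x y)) (hhi' : ∀ y, Integrable (fun x => h' x y))
    (hhI' : Integrable (fun p : ℝ × Y => h' p.1 p.2) (volume.prod μ))
    (hρm : Measurable (fun p : ℝ × Y => ρ p.1 p.2)) (hhm : Measurable (fun p : ℝ × Y => h p.1 p.2))
    (hUm : Measurable (fun p : ℝ × Y => cdf (fun t => ρ t p.2) p.1))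
    (hb : ∀ x y, |h x y| ≤ b y) (hbi : Integrable b μ) :
    Integrable (fun p : ℝ × Y => h p.1 p.2 * (P' (cdf (fun t => ρ t p.2) p.1) * ρ p.1 p.2))
      (volume.prod μ) ∧
    Integrable (fun p : ℝ × Y => h' p.1 p.2 * P (cdf (fun t => ρ t p.2) p.1)) (volume.prod μ) ∧
    ∫ p : ℝ × Y, h p.1 p.2 * (P' (cdf (fun t => ρ t p.2) p.1) * ρ p.1 p.2) ∂(volume.prod μ)
      = - ∫ p : ℝ × Y, h' p.1 p.2 * P (cdf (fun t => ρ t p.2) p.1) ∂(volume.prod μ) := by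
  have hPc : Continuous P := continuous_iff_continuousAt.2 fun x => (hP x).continuousAt
  obtain ⟨C, hC0, hC⟩ := bdd_of_cont hPc
  obtain ⟨C', hC0', hC'⟩ := bdd_of_cont hP'
  have hm : ∀ x y, cdf (fun t => ρ t y) x ∈ Set.Icc (0:ℝ) 1 := fun x y =>
    ⟨cdf_nonneg (fun t => h0 t y) x, (cdf_le (fun t => h0 t y) (hi y) x).trans (h1 y)⟩
  have hmeas : Measurable
      (fun p : ℝ × Y => h p.1 p.2 * (P' (cdf (fun t => ρ t p.2) p.1) * ρ p.1 p.2)) :=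
    hhm.mul ((hP'.measurable.comp hUm).mul hρm)
  have hbound : ∀ x y, |h x y * (P' (cdf (fun t => ρ t y) x) * ρ x y)| ≤ b y * C' * ρ x y := by
    intro x y
    rw [abs_mul, abs_mul, ← mul_assoc, abs_of_nonneg (h0 x y)]
    exact mul_le_mul_of_nonneg_right (mul_le_mul (hb x y) (hC' _ (hm x y)) (abs_nonneg _)
      ((abs_nonneg _).trans (hb x y))) (h0 x y)
  have hslice : ∀ y, Integrable (fun x => h x y * (P' (cdf (fun t => ρ t y) x) * ρ x y)) := by
    intro y
    refine ((hi y).const_mul (b y * C')).mono' ?_ (Filter.Eventually.of_forall fun x => hbound x y)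
    exact (hmeas.comp (measurable_id.prodMk measurable_const)).aestronglyMeasurable
  have hI : Integrable (fun p : ℝ × Y => h p.1 p.2 * (P' (cdf (fun t => ρ t p.2) p.1) * ρ p.1 p.2))
      (volume.prod μ) := by
    rw [integrable_prod_iff' hmeas.aestronglyMeasurable]
    refine ⟨Filter.Eventually.of_forall hslice, ?_⟩
    refine (hbi.mul_const C').mono' ?_ (Filter.Eventually.of_forall fun y => ?_)
    · exact (hmeas.norm.stronglyMeasurable.integral_prod_left'
        (μ := (volume : Measure ℝ))).aestronglyMeasurable
    · rw [Real.norm_eq_abs, abs_of_nonneg (integral_nonneg fun _ => norm_nonneg _)]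
      calc ∫ x, ‖h x y * (P' (cdf (fun t => ρ t y) x) * ρ x y)‖
          ≤ ∫ x, b y * C' * ρ x y :=
            integral_mono (hslice y).norm ((hi y).const_mul _) fun x => hbound x y
        _ = b y * C' * ∫ x, ρ x y := integral_const_mul _ _
        _ ≤ b y * C' * 1 := mul_le_mul_of_nonneg_left (h1 y)
            (mul_nonneg ((abs_nonneg _).trans (hb 0 y)) hC0')
        _ = b y * C' := mul_one _
  have hI2 : Integrable (fun p : ℝ × Y => h' p.1 p.2 * P (cdf (fun t => ρ t p.2) p.1))
      (volume.prod μ) :=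
    hhI'.mul_bdd (c := C) (hPc.measurable.comp hUm).aestronglyMeasurable
      (Filter.Eventually.of_forall fun p => hC _ (hm _ _))
  refine ⟨hI, hI2, ?_⟩
  rw [integral_prod_symm _ hI, integral_prod_symm _ hI2, ← integral_neg]
  congr 1
  funext y
  exact ibp_one (fun t => h0 t y) (hc y) (hi y) (h1 y) hP hP' (fun x => hh x y) (hhi y) (hhi' y)
    (fun x => hb x y)

/-- optimisation lemma -/
lemma amgm_opt {X B M : ℝ} (hB : 0 ≤ B) (hM : 0 ≤ M)
    (h : ∀ k : ℝ, 0 < k → 2 * X ≤ B / k + k * M) : X ≤ √B * √M := by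
  by_cases hX : X ≤ 0
  · exact hX.trans (by positivity)
  push Not at hX
  rw [← Real.sqrt_mul hB]
  apply Real.le_sqrt_of_sq_le
  have : discrim M (-2 * X) B ≤ 0 := by
    apply discrim_le_zero
    intro x
    rcases le_or_gt x 0 with hx | hx
    · nlinarith [mul_nonneg hM (mul_self_nonneg x), mul_nonneg hX.le (neg_nonneg.2 hx)]
    · have := h x hx
      have h2 : 2 * X * x ≤ (B / x + x * M) * x := mul_le_mul_of_nonneg_right this hx.le
      have h3 : (B / x + x * M) * x = B + M * (x * x) := by field_simp
      rw [h3] at h2; linarith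
  simp only [discrim] at this
  nlinarith

lemma measurable_cdf {Y : Type*} [MeasurableSpace Y] {ρ : ℝ → Y → ℝ}
    (hρm : Measurable (fun p : ℝ × Y => ρ p.1 p.2)) :
    Measurable (fun p : ℝ × Y => cdf (fun t => ρ t p.2) p.1) := by
  have h1 : Measurable (fun q : (ℝ × Y) × ℝ =>
      Set.indicator {q : (ℝ × Y) × ℝ | q.2 ≤ q.1.1} (fun q => ρ q.2 q.1.2) q) := by
    apply Measurable.indicator
    · exact hρm.comp (measurable_snd.prodMk (measurable_snd.comp measurable_fst))
    · exact measurableSet_le measurable_snd (measurable_fst.comp measurable_fst)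
  have h2 := (h1.stronglyMeasurable.integral_prod_right' (ν := (volume : Measure ℝ))).measurable
  convert h2 using 1
  funext p
  simp only [cdf]
  rw [← integral_indicator measurableSet_Iic]
  rfl

end GN

namespace GN

def rr (x : ℝ) : ℝ := (1 + x ^ 2)⁻¹

lemma rr_pos (x : ℝ) : 0 < rr x := by unfold rr; positivity
lemma rr_le_one (x : ℝ) : rr x ≤ 1 := by
  unfold rr; exact inv_le_one_of_one_le₀ (by nlinarith [sq_nonneg x])
lemma rr_int : Integrable rr := integrable_inv_one_add_sq
lemma rr_cont : Continuous rr := by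
  unfold rr
  exact (by fun_prop : Continuous fun x : ℝ => 1 + x ^ 2).inv₀ fun x => by positivity

def Dec (G : ℝ → ℝ → ℝ → ℝ) : Prop :=
  Continuous (fun p : ℝ × ℝ × ℝ => G p.1 p.2.1 p.2.2) ∧
    ∃ C, 0 ≤ C ∧ ∀ x y z, |G x y z| ≤ C * (rr x * rr y * rr z)

lemma Dec.swap {G : ℝ → ℝ → ℝ → ℝ} (h : Dec G) : Dec (fun y x z => G x y z) := by
  obtain ⟨hc, C, hC0, hC⟩ := h
  refine ⟨hc.comp (by fun_prop : Continuous fun p : ℝ × ℝ × ℝ => (p.2.1, p.1, p.2.2)),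
    C, hC0, fun x y z => ?_⟩
  rw [mul_comm (rr x)]; exact hC y x z

lemma Dec.rot {G : ℝ → ℝ → ℝ → ℝ} (h : Dec G) : Dec (fun z x y => G x y z) := by
  obtain ⟨hc, C, hC0, hC⟩ := h
  refine ⟨hc.comp (by fun_prop : Continuous fun p : ℝ × ℝ × ℝ => (p.2.1, p.2.2, p.1)),
    C, hC0, fun x y z => (hC y z x).trans (le_of_eq (by ring))⟩

lemma Dec.integrable {G : ℝ → ℝ → ℝ → ℝ} (h : Dec G) :
    Integrable (fun p : ℝ × ℝ × ℝ => G p.1 p.2.1 p.2.2) := by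
  obtain ⟨hc, C, hC0, hC⟩ := h
  have := (rr_int.mul_prod (rr_int.mul_prod rr_int)).const_mul C
  refine this.mono' hc.aestronglyMeasurable (Filter.Eventually.of_forall fun p => ?_)
  refine (hC _ _ _).trans (le_of_eq (by ring))

lemma Dec.slice {G : ℝ → ℝ → ℝ → ℝ} (h : Dec G) (y z : ℝ) : Integrable (fun x => G x y z) := by
  obtain ⟨hc, C, hC0, hC⟩ := h
  refine (rr_int.const_mul C).mono'
    (hc.comp (by fun_prop : Continuous fun x : ℝ => (x, y, z))).aestronglyMeasurable
    (Filter.Eventually.of_forall fun x => ?_)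
  refine (hC x y z).trans (mul_le_mul_of_nonneg_left ?_ hC0)
  have := rr_le_one y; have := rr_le_one z
  have h1 := rr_pos x; have h2 := rr_pos y; have h3 := rr_pos z
  calc rr x * rr y * rr z ≤ rr x * 1 * 1 := by gcongr
    _ = rr x := by ring

lemma Dec.sliceCont {G : ℝ → ℝ → ℝ → ℝ} (h : Dec G) (y z : ℝ) : Continuous (fun x => G x y z) :=
  h.1.comp (by fun_prop : Continuous fun x : ℝ => (x, y, z))

/-- bound for the sup in the first variable -/
lemma Dec.bd {G : ℝ → ℝ → ℝ → ℝ} (h : Dec G) : ∃ b : ℝ × ℝ → ℝ, Integrable b ∧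
    ∀ x p, |G x p.1 p.2| ≤ b p := by
  obtain ⟨hc, C, hC0, hC⟩ := h
  refine ⟨fun p => C * (rr p.1 * rr p.2), (rr_int.mul_prod rr_int).const_mul C, fun x p => ?_⟩
  refine (hC x p.1 p.2).trans (mul_le_mul_of_nonneg_left ?_ hC0)
  have h1 := rr_pos x; have h2 := rr_pos p.1; have h3 := rr_pos p.2
  calc rr x * rr p.1 * rr p.2 ≤ 1 * rr p.1 * rr p.2 := by gcongr; exact rr_le_one x
    _ = _ := by ring

def Dec2 (G : ℝ → ℝ → ℝ) : Prop :=
  Continuous (fun p : ℝ × ℝ => G p.1 p.2) ∧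
    ∃ C, 0 ≤ C ∧ ∀ x y, |G x y| ≤ C * (rr x * rr y)

def Dec1 (G : ℝ → ℝ) : Prop :=
  Continuous G ∧ ∃ C, 0 ≤ C ∧ ∀ x, |G x| ≤ C * rr x

lemma Dec.marg {G : ℝ → ℝ → ℝ → ℝ} (h : Dec G) : Dec2 (fun x y => ∫ z, G x y z) := by
  obtain ⟨hc, C, hC0, hC⟩ := h
  have key : ∀ x y z, |G x y z| ≤ C * rr z := fun x y z => by
    refine (hC x y z).trans (mul_le_mul_of_nonneg_left ?_ hC0)
    have h1 := rr_pos x; have h2 := rr_pos y; have h3 := rr_pos z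
    calc rr x * rr y * rr z ≤ 1 * 1 * rr z := by gcongr <;> exact rr_le_one _
      _ = rr z := by ring
  refine ⟨?_, C * ∫ z, rr z, mul_nonneg hC0 (integral_nonneg fun z => (rr_pos z).le), fun x y => ?_⟩
  · refine continuous_of_dominated (bound := fun z => C * rr z) ?_ ?_ (rr_int.const_mul C) ?_
    · intro p
      exact (hc.comp (by fun_prop : Continuous fun z : ℝ => (p.1, p.2, z))).aestronglyMeasurable
    · intro p; exact Filter.Eventually.of_forall fun z => key _ _ _
    · exact Filter.Eventually.of_forall fun z =>
        hc.comp (by fun_prop : Continuous fun p : ℝ × ℝ => (p.1, p.2, z))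
  · rw [← Real.norm_eq_abs]
    refine (norm_integral_le_of_norm_le (rr_int.const_mul (C * (rr x * rr y)))
      (Filter.Eventually.of_forall fun z => ?_)).trans (le_of_eq ?_)
    · exact (hC x y z).trans (le_of_eq (by ring))
    · rw [integral_const_mul]; ring

lemma Dec2.marg {G : ℝ → ℝ → ℝ} (h : Dec2 G) : Dec1 (fun x => ∫ z, G x z) := by
  obtain ⟨hc, C, hC0, hC⟩ := h
  have key : ∀ x z, |G x z| ≤ C * rr z := fun x z => by
    refine (hC x z).trans (mul_le_mul_of_nonneg_left ?_ hC0)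
    have h1 := rr_pos x; have h3 := rr_pos z
    calc rr x * rr z ≤ 1 * rr z := by gcongr; exact rr_le_one _
      _ = rr z := by ring
  refine ⟨?_, C * ∫ z, rr z, mul_nonneg hC0 (integral_nonneg fun z => (rr_pos z).le), fun x => ?_⟩
  · refine continuous_of_dominated (bound := fun z => C * rr z) ?_ ?_ (rr_int.const_mul C) ?_
    · intro p
      exact (hc.comp (by fun_prop : Continuous fun z : ℝ => (p, z))).aestronglyMeasurable
    · intro p; exact Filter.Eventually.of_forall fun z => key _ _
    · exact Filter.Eventually.of_forall fun z =>
        hc.comp (by fun_prop : Continuous fun p : ℝ => (p, z))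
  · rw [← Real.norm_eq_abs]
    refine (norm_integral_le_of_norm_le (rr_int.const_mul (C * rr x))
      (Filter.Eventually.of_forall fun z => ?_)).trans (le_of_eq ?_)
    · exact (hC x z).trans (le_of_eq (by ring))
    · rw [integral_const_mul]; ring

lemma Dec2.slice {G : ℝ → ℝ → ℝ} (h : Dec2 G) (x : ℝ) : Integrable (fun y => G x y) := by
  obtain ⟨hc, C, hC0, hC⟩ := h
  refine (rr_int.const_mul C).mono'
    (hc.comp (by fun_prop : Continuous fun y : ℝ => (x, y))).aestronglyMeasurable
    (Filter.Eventually.of_forall fun y => ?_)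
  refine (hC x y).trans (mul_le_mul_of_nonneg_left ?_ hC0)
  have h1 := rr_pos x; have h2 := rr_pos y
  calc rr x * rr y ≤ 1 * rr y := by gcongr; exact rr_le_one _
    _ = rr y := by ring

lemma Dec1.integrable {G : ℝ → ℝ} (h : Dec1 G) : Integrable G := by
  obtain ⟨hc, C, hC0, hC⟩ := h
  exact (rr_int.const_mul C).mono' hc.aestronglyMeasurable (Filter.Eventually.of_forall hC)

/-- normalised substitution -/
lemma integral_ncdf {f : ℝ → ℝ} (h0 : ∀ x, 0 ≤ f x) (hc : Continuous f) (hi : Integrable f)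
    {ψ : ℝ → ℝ} (hψ : Continuous ψ) :
    ∫ x, f x * ψ (cdf (fun t => f t / ∫ s, f s) x) = (∫ s, f s) * ∫ u in (0:ℝ)..1, ψ u := by
  set m := ∫ s, f s with hm
  by_cases hm0 : m = 0
  · have : f = 0 := by
      have h2 := (integral_eq_zero_iff_of_nonneg h0 hi).1 (hm ▸ hm0)
      exact (Continuous.ae_eq_iff_eq volume hc continuous_zero).1 h2
    rw [hm0]; simp [this]
  have hmp : 0 < m := lt_of_le_of_ne (integral_nonneg h0) (Ne.symm hm0)
  have ht : ∫ t, f t / m = 1 := by rw [integral_div, ← hm, div_self hm0]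
  have := integral_cdf (ρ := fun t => f t / m) (fun x => div_nonneg (h0 x) hmp.le)
    (hc.div_const m) (hi.div_const m) ht.le hψ
  rw [ht] at this
  rw [← this, ← integral_const_mul]
  congr 1; funext x; field_simp

/-- total mass of normalised densities -/
lemma nmass {f : ℝ → ℝ} : ∫ t, f t / ∫ s, f s ≤ 1 := by
  rw [integral_div]; exact div_self_le_one _

lemma mp2 : MeasurePreserving (fun p : ℝ × ℝ × ℝ => ((p.2.1, p.1, p.2.2) : ℝ × ℝ × ℝ)) := by
  have h1 := (volume_preserving_prodAssoc (α₁ := ℝ) (β₁ := ℝ) (γ₁ := ℝ))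
  have h2 := h1.symm
  have h3 : MeasurePreserving (Prod.map (Prod.swap : ℝ × ℝ → ℝ × ℝ) (id : ℝ → ℝ)) :=
    (Measure.measurePreserving_swap (μ := (volume : Measure ℝ)) (ν := (volume : Measure ℝ))).prod
      (MeasurePreserving.id volume)
  exact h1.comp (h3.comp h2)

lemma mp3 : MeasurePreserving (fun p : ℝ × ℝ × ℝ => ((p.2.1, p.2.2, p.1) : ℝ × ℝ × ℝ)) := by
  have h1 := (volume_preserving_prodAssoc (α₁ := ℝ) (β₁ := ℝ) (γ₁ := ℝ))
  have h3 : MeasurePreserving (Prod.swap : ℝ × (ℝ × ℝ) → (ℝ × ℝ) × ℝ) :=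
    (Measure.measurePreserving_swap (μ := (volume : Measure ℝ)) (ν := (volume : Measure (ℝ × ℝ))))
  exact h1.comp h3

lemma me2 : MeasurableEmbedding (fun p : ℝ × ℝ × ℝ => ((p.2.1, p.1, p.2.2) : ℝ × ℝ × ℝ)) :=
  (⟨⟨fun p => (p.2.1, p.1, p.2.2), fun p => (p.2.1, p.1, p.2.2), fun _ => rfl, fun _ => rfl⟩,
    by simp only [Equiv.coe_fn_mk]; fun_prop, by simp only [Equiv.symm, Equiv.coe_fn_mk]; fun_prop⟩ :
    (ℝ × ℝ × ℝ) ≃ᵐ (ℝ × ℝ × ℝ)).measurableEmbedding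

lemma me3 : MeasurableEmbedding (fun p : ℝ × ℝ × ℝ => ((p.2.1, p.2.2, p.1) : ℝ × ℝ × ℝ)) :=
  (⟨⟨fun p => (p.2.1, p.2.2, p.1), fun p => (p.2.2, p.1, p.2.1), fun _ => rfl, fun _ => rfl⟩,
    by simp only [Equiv.coe_fn_mk]; fun_prop, by simp only [Equiv.symm, Equiv.coe_fn_mk]; fun_prop⟩ :
    (ℝ × ℝ × ℝ) ≃ᵐ (ℝ × ℝ × ℝ)).measurableEmbedding

lemma amgm6 {G H a b c : ℝ} (hG : 0 ≤ G) (hH : 0 ≤ H) (ha : 0 ≤ a) (hb : 0 ≤ b) (hc : 0 ≤ c)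
    (h : G ^ 6 = H ^ 6 * (a * b * c)) : G ≤ H / 2 + (H * a + H * b + H * c) / 6 := by
  set A := (a + b + c) / 3 with hA
  have hA0 : 0 ≤ A := by positivity
  have h1 : a * b * c ≤ A ^ 3 := by
    have h2 : 0 ≤ (a + b + c) * ((a - b) ^ 2 + (b - c) ^ 2 + (a - c) ^ 2) := by positivity
    have h3 : 0 ≤ a * (b - c) ^ 2 + b * (a - c) ^ 2 + c * (a - b) ^ 2 := by positivity
    rw [hA]
    nlinarith [h2, h3]
  have h2 : A ^ 3 ≤ ((1 + A) / 2) ^ 6 := by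
    have : A ≤ ((1 + A) / 2) ^ 2 := by nlinarith [sq_nonneg (1 - A)]
    calc A ^ 3 ≤ (((1 + A) / 2) ^ 2) ^ 3 := by gcongr
      _ = _ := by ring
  have h3 : G ^ 6 ≤ (H * ((1 + A) / 2)) ^ 6 := by
    rw [h, mul_pow]; gcongr; exact h1.trans h2
  have h4 := le_of_pow_le_pow_left₀ (by norm_num) (by positivity) h3
  refine h4.trans (le_of_eq ?_)
  rw [hA]; ring

end GN

namespace GN

def M2 (F : ℝ → ℝ → ℝ → ℝ) (x y : ℝ) : ℝ := ∫ z, F x y z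
def M1 (F : ℝ → ℝ → ℝ → ℝ) (x : ℝ) : ℝ := ∫ y, M2 F x y
def M0 (F : ℝ → ℝ → ℝ → ℝ) : ℝ := ∫ x, M1 F x
def U1 (F : ℝ → ℝ → ℝ → ℝ) (x : ℝ) : ℝ := cdf (fun t => M1 F t / M0 F) x
def U2 (F : ℝ → ℝ → ℝ → ℝ) (x y : ℝ) : ℝ := cdf (fun t => M2 F x t / M1 F x) y
def U3 (F : ℝ → ℝ → ℝ → ℝ) (x y z : ℝ) : ℝ := cdf (fun t => F x y t / M2 F x y) z

section
variable {F : ℝ → ℝ → ℝ → ℝ}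

lemma M2_nonneg (h0 : ∀ x y z, 0 ≤ F x y z) (x y : ℝ) : 0 ≤ M2 F x y :=
  integral_nonneg fun z => h0 x y z
lemma M1_nonneg (h0 : ∀ x y z, 0 ≤ F x y z) (x : ℝ) : 0 ≤ M1 F x :=
  integral_nonneg fun z => M2_nonneg h0 x z
lemma M0_nonneg (h0 : ∀ x y z, 0 ≤ F x y z) : 0 ≤ M0 F :=
  integral_nonneg fun z => M1_nonneg h0 z
lemma M2_dec (h : Dec F) : Dec2 (M2 F) := h.marg
lemma M1_dec (h : Dec F) : Dec1 (M1 F) := (M2_dec h).marg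

lemma cont3 (h : Dec F) (x y : ℝ) : Continuous (fun z => F x y z) := h.rot.sliceCont x y
lemma cont2 (h : Dec F) (x : ℝ) : Continuous (fun y => M2 F x y) :=
  (M2_dec h).1.comp (by fun_prop : Continuous fun y : ℝ => (x, y))

lemma U1_meas (h : Dec F) : Measurable (fun p : ℝ × ℝ × ℝ => U1 F p.1) := by
  have : Measurable (U1 F) := (cdf_continuous ((M1_dec h).1.div_const _)
    ((M1_dec h).integrable.div_const _)).measurable
  exact this.comp measurable_fst

lemma U2_meas (h : Dec F) : Measurable (fun p : ℝ × ℝ × ℝ => U2 F p.1 p.2.1) := by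
  have := measurable_cdf (Y := ℝ) (ρ := fun t x => M2 F x t / M1 F x)
    (((M2_dec h).1.measurable.comp measurable_swap).div ((M1_dec h).1.measurable.comp measurable_snd))
  exact this.comp (measurable_fst.comp measurable_snd |>.prodMk measurable_fst)

lemma U3_meas (h : Dec F) : Measurable (fun p : ℝ × ℝ × ℝ => U3 F p.1 p.2.1 p.2.2) := by
  have := measurable_cdf (Y := ℝ × ℝ) (ρ := fun t q => F q.1 q.2 t / M2 F q.1 q.2)
    ((h.rot.1.measurable).div ((M2_dec h).1.measurable.comp measurable_snd))
  exact this.comp (f := fun p : ℝ × ℝ × ℝ => (p.2.2, (p.1, p.2.1))) (by fun_prop)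

lemma U1_mem (h0 : ∀ x y z, 0 ≤ F x y z) (h : Dec F) (x : ℝ) : U1 F x ∈ Set.Icc (0:ℝ) 1 :=
  ⟨cdf_nonneg (fun t => div_nonneg (M1_nonneg h0 t) (M0_nonneg h0)) x,
   (cdf_le (fun t => div_nonneg (M1_nonneg h0 t) (M0_nonneg h0))
    ((M1_dec h).integrable.div_const _) x).trans nmass⟩
lemma U2_mem (h0 : ∀ x y z, 0 ≤ F x y z) (h : Dec F) (x y : ℝ) : U2 F x y ∈ Set.Icc (0:ℝ) 1 :=
  ⟨cdf_nonneg (fun t => div_nonneg (M2_nonneg h0 x t) (M1_nonneg h0 x)) y,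
   (cdf_le (fun t => div_nonneg (M2_nonneg h0 x t) (M1_nonneg h0 x))
    (((M2_dec h).slice x).div_const _) y).trans nmass⟩
lemma U3_mem (h0 : ∀ x y z, 0 ≤ F x y z) (h : Dec F) (x y z : ℝ) :
    U3 F x y z ∈ Set.Icc (0:ℝ) 1 :=
  ⟨cdf_nonneg (fun t => div_nonneg (h0 x y t) (M2_nonneg h0 x y)) z,
   (cdf_le (fun t => div_nonneg (h0 x y t) (M2_nonneg h0 x y))
    ((h.rot.slice x y).div_const _) z).trans nmass⟩

lemma integrable_psi (h0 : ∀ x y z, 0 ≤ F x y z) (h : Dec F) {ψ1 ψ2 ψ3 : ℝ → ℝ}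
    (c1 : Continuous ψ1) (c2 : Continuous ψ2) (c3 : Continuous ψ3) :
    Integrable (fun p : ℝ × ℝ × ℝ => F p.1 p.2.1 p.2.2 *
      (ψ1 (U1 F p.1) * (ψ2 (U2 F p.1 p.2.1) * ψ3 (U3 F p.1 p.2.1 p.2.2)))) := by
  obtain ⟨C1, h10, h1⟩ := bdd_of_cont c1
  obtain ⟨C2, h20, h2⟩ := bdd_of_cont c2
  obtain ⟨C3, h30, h3⟩ := bdd_of_cont c3
  refine h.integrable.mul_bdd (c := C1 * (C2 * C3)) ?_ (Filter.Eventually.of_forall fun p => ?_)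
  · exact ((c1.measurable.comp (U1_meas h)).mul ((c2.measurable.comp (U2_meas h)).mul
      (c3.measurable.comp (U3_meas h)))).aestronglyMeasurable
  · rw [Real.norm_eq_abs, abs_mul, abs_mul]
    have e1 := h1 _ (U1_mem h0 h p.1)
    have e2 := h2 _ (U2_mem h0 h p.1 p.2.1)
    have e3 := h3 _ (U3_mem h0 h p.1 p.2.1 p.2.2)
    gcongr

lemma integral_psi (h0 : ∀ x y z, 0 ≤ F x y z) (h : Dec F) {ψ1 ψ2 ψ3 : ℝ → ℝ}
    (c1 : Continuous ψ1) (c2 : Continuous ψ2) (c3 : Continuous ψ3) :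
    ∫ p : ℝ × ℝ × ℝ, F p.1 p.2.1 p.2.2 *
      (ψ1 (U1 F p.1) * (ψ2 (U2 F p.1 p.2.1) * ψ3 (U3 F p.1 p.2.1 p.2.2))) =
    M0 F * ((∫ u in (0:ℝ)..1, ψ1 u) * ((∫ u in (0:ℝ)..1, ψ2 u) * ∫ u in (0:ℝ)..1, ψ3 u)) := by
  have hI := integrable_psi h0 h c1 c2 c3
  have hstep : ∀ x, (∫ q : ℝ × ℝ, F x q.1 q.2 *
      (ψ1 (U1 F x) * (ψ2 (U2 F x q.1) * ψ3 (U3 F x q.1 q.2)))) =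
      ψ1 (U1 F x) * (M1 F x * ((∫ u in (0:ℝ)..1, ψ2 u) * ∫ u in (0:ℝ)..1, ψ3 u)) := by
    intro x
    obtain ⟨C1, h10, h1⟩ := bdd_of_cont c1
    obtain ⟨C2, h20, h2⟩ := bdd_of_cont c2
    obtain ⟨C3, h30, h3⟩ := bdd_of_cont c3
    have hIx : Integrable (fun q : ℝ × ℝ => F x q.1 q.2 *
      (ψ1 (U1 F x) * (ψ2 (U2 F x q.1) * ψ3 (U3 F x q.1 q.2)))) := by
      have hFx : Integrable (fun q : ℝ × ℝ => F x q.1 q.2) := by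
        obtain ⟨b, hb, hb'⟩ := h.bd
        exact hb.mono' (h.1.comp (by fun_prop : Continuous fun q : ℝ × ℝ => (x, q.1, q.2))).aestronglyMeasurable
          (Filter.Eventually.of_forall fun q => hb' x q)
      have mm : Measurable (fun q : ℝ × ℝ => ((x, q.1, q.2) : ℝ × ℝ × ℝ)) := by fun_prop
      refine hFx.mul_bdd (c := C1 * (C2 * C3)) ?_ (Filter.Eventually.of_forall fun p => ?_)
      · exact (((c1.measurable.comp (U1_meas h)).mul ((c2.measurable.comp (U2_meas h)).mul
          (c3.measurable.comp (U3_meas h)))).comp mm).aestronglyMeasurable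
      · rw [Real.norm_eq_abs, abs_mul, abs_mul]
        have e1 := h1 _ (U1_mem h0 h x)
        have e2 := h2 _ (U2_mem h0 h x p.1)
        have e3 := h3 _ (U3_mem h0 h x p.1 p.2)
        gcongr
    rw [Measure.volume_eq_prod, integral_prod _ hIx]
    have inner : ∀ y, (∫ z, F x y z * (ψ1 (U1 F x) * (ψ2 (U2 F x y) * ψ3 (U3 F x y z)))) =
        (ψ1 (U1 F x) * ∫ u in (0:ℝ)..1, ψ3 u) * (M2 F x y * ψ2 (U2 F x y)) := by
      intro y
      have := integral_ncdf (f := fun z => F x y z) (h0 x y) (cont3 h x y) (h.rot.slice x y) c3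
      calc (∫ z, F x y z * (ψ1 (U1 F x) * (ψ2 (U2 F x y) * ψ3 (U3 F x y z))))
          = ∫ z, (ψ1 (U1 F x) * ψ2 (U2 F x y)) * (F x y z * ψ3 (U3 F x y z)) := by
            congr 1; funext z; ring
        _ = (ψ1 (U1 F x) * ψ2 (U2 F x y)) * (M2 F x y * ∫ u in (0:ℝ)..1, ψ3 u) := by
            rw [integral_const_mul]; congr 1
        _ = _ := by ring
    simp only [inner]
    rw [integral_const_mul]
    have := integral_ncdf (f := fun y => M2 F x y) (M2_nonneg h0 x) (cont2 h x) ((M2_dec h).slice x) c2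
    have h4 : ∫ y, M2 F x y * ψ2 (U2 F x y) = M1 F x * ∫ u in (0:ℝ)..1, ψ2 u := this
    rw [h4]; ring
  rw [Measure.volume_eq_prod, integral_prod _ hI]
  simp only [hstep]
  have := integral_ncdf (f := M1 F) (M1_nonneg h0) (M1_dec h).1 (M1_dec h).integrable c1
  have h4 : ∫ x, M1 F x * ψ1 (U1 F x) = M0 F * ∫ u in (0:ℝ)..1, ψ1 u := this
  calc _ = ∫ x, ((∫ u in (0:ℝ)..1, ψ2 u) * ∫ u in (0:ℝ)..1, ψ3 u) * (M1 F x * ψ1 (U1 F x)) := by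
        congr 1; funext x; ring
    _ = _ := by rw [integral_const_mul, h4]; ring

lemma M0_eq (h : Dec F) : M0 F = ∫ p : ℝ × ℝ × ℝ, F p.1 p.2.1 p.2.2 := by
  have hFx : ∀ x, Integrable (fun q : ℝ × ℝ => F x q.1 q.2) := fun x => by
    obtain ⟨b, hb, hb'⟩ := h.bd
    exact hb.mono' (h.1.comp (by fun_prop : Continuous fun q : ℝ × ℝ => (x, q.1, q.2))).aestronglyMeasurable
      (Filter.Eventually.of_forall fun q => hb' x q)
  rw [Measure.volume_eq_prod, integral_prod _ h.integrable]
  unfold M0 M1 M2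
  congr 1; funext x
  rw [Measure.volume_eq_prod, integral_prod _ (hFx x)]

lemma prod_rho (h0 : ∀ x y z, 0 ≤ F x y z) (h : Dec F) (x y z : ℝ) :
    (M1 F x / M0 F) * (M2 F x y / M1 F x) * (F x y z / M2 F x y) = F x y z / M0 F := by
  have z2 : M2 F x y = 0 → F x y z = 0 := fun hz => by
    have h2 := (integral_eq_zero_iff_of_nonneg (h0 x y) (h.rot.slice x y)).1 hz
    exact congrFun ((Continuous.ae_eq_iff_eq volume (cont3 h x y) continuous_zero).1 h2) z
  have z1 : M1 F x = 0 → M2 F x y = 0 := fun hz => by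
    have h2 := (integral_eq_zero_iff_of_nonneg (M2_nonneg h0 x) ((M2_dec h).slice x)).1 hz
    exact congrFun ((Continuous.ae_eq_iff_eq volume (cont2 h x) continuous_zero).1 h2) y
  by_cases hz2 : M2 F x y = 0
  · simp [hz2, z2 hz2]
  by_cases hz1 : M1 F x = 0
  · exact absurd (z1 hz1) hz2
  field_simp

variable {H H' : ℝ → ℝ → ℝ → ℝ} {P P' : ℝ → ℝ}

lemma ibp1 (h0 : ∀ x y z, 0 ≤ F x y z) (h : Dec F) (hH : Dec H) (hH' : Dec H')
    (hP : ∀ u, HasDerivAt P (P' u) u) (hP' : Continuous P')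
    (hd : ∀ x y z, HasDerivAt (fun t => H t y z) (H' x y z) x) :
    Integrable (fun p : ℝ × ℝ × ℝ => H p.1 p.2.1 p.2.2 * (P' (U1 F p.1) * (M1 F p.1 / M0 F))) ∧
    Integrable (fun p : ℝ × ℝ × ℝ => H' p.1 p.2.1 p.2.2 * P (U1 F p.1)) ∧
    ∫ p : ℝ × ℝ × ℝ, H p.1 p.2.1 p.2.2 * (P' (U1 F p.1) * (M1 F p.1 / M0 F)) =
    - ∫ p : ℝ × ℝ × ℝ, H' p.1 p.2.1 p.2.2 * P (U1 F p.1) := by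
  obtain ⟨b, hb, hb'⟩ := hH.bd
  exact ibp_param (Y := ℝ × ℝ) (μ := volume) (ρ := fun t _ => M1 F t / M0 F)
    (h := fun x q => H x q.1 q.2) (h' := fun x q => H' x q.1 q.2) (b := b)
    (fun x _ => div_nonneg (M1_nonneg h0 x) (M0_nonneg h0))
    (fun _ => (M1_dec h).1.div_const _) (fun _ => (M1_dec h).integrable.div_const _)
    (fun _ => nmass) hP hP' (fun x q => hd x q.1 q.2) (fun q => hH.slice _ _)
    (fun q => hH'.slice _ _) hH'.integrable
    (((M1_dec h).1.measurable.comp measurable_fst).div_const _) hH.1.measurable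
    (U1_meas h) hb' hb

lemma transfer {e : ℝ × ℝ × ℝ → ℝ × ℝ × ℝ} (mp : MeasurePreserving e)
    (me : MeasurableEmbedding e) {f g : ℝ × ℝ × ℝ → ℝ}
    (h : Integrable (fun p => f (e p)) ∧ Integrable (fun p => g (e p)) ∧
      ∫ p, f (e p) = - ∫ p, g (e p)) :
    Integrable f ∧ Integrable g ∧ ∫ p, f p = - ∫ p, g p := by
  obtain ⟨h1, h2, h3⟩ := h
  rw [mp.integral_comp me, mp.integral_comp me] at h3
  exact ⟨(mp.integrable_comp_emb me).1 h1, (mp.integrable_comp_emb me).1 h2, h3⟩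

lemma ibp2 (h0 : ∀ x y z, 0 ≤ F x y z) (h : Dec F) (hH : Dec H) (hH' : Dec H')
    (hP : ∀ u, HasDerivAt P (P' u) u) (hP' : Continuous P')
    (hd : ∀ x y z, HasDerivAt (fun t => H x t z) (H' x y z) y) :
    Integrable (fun p : ℝ × ℝ × ℝ => H p.1 p.2.1 p.2.2 *
      (P' (U2 F p.1 p.2.1) * (M2 F p.1 p.2.1 / M1 F p.1))) ∧
    Integrable (fun p : ℝ × ℝ × ℝ => H' p.1 p.2.1 p.2.2 * P (U2 F p.1 p.2.1)) ∧
    ∫ p : ℝ × ℝ × ℝ, H p.1 p.2.1 p.2.2 * (P' (U2 F p.1 p.2.1) * (M2 F p.1 p.2.1 / M1 F p.1)) =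
    - ∫ p : ℝ × ℝ × ℝ, H' p.1 p.2.1 p.2.2 * P (U2 F p.1 p.2.1) := by
  obtain ⟨b, hb, hb'⟩ := hH.swap.bd
  refine transfer mp2 me2 ?_
  exact ibp_param (Y := ℝ × ℝ) (μ := volume) (ρ := fun t q => M2 F q.1 t / M1 F q.1)
    (h := fun x q => H q.1 x q.2) (h' := fun x q => H' q.1 x q.2) (b := b)
    (fun x q => div_nonneg (M2_nonneg h0 _ x) (M1_nonneg h0 _))
    (fun q => (cont2 h q.1).div_const _) (fun q => ((M2_dec h).slice q.1).div_const _)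
    (fun _ => nmass) hP hP' (fun x q => hd q.1 x q.2) (fun q => hH.swap.slice _ _)
    (fun q => hH'.swap.slice _ _) hH'.swap.integrable
    (((M2_dec h).1.measurable.comp (by fun_prop : Measurable fun p : ℝ × ℝ × ℝ => (p.2.1, p.1))).div
      ((M1_dec h).1.measurable.comp (by fun_prop : Measurable fun p : ℝ × ℝ × ℝ => p.2.1)))
    hH.swap.1.measurable
    ((U2_meas h).comp (by fun_prop : Measurable fun p : ℝ × ℝ × ℝ => (p.2.1, p.1, p.2.2))) hb' hb

lemma ibp3 (h0 : ∀ x y z, 0 ≤ F x y z) (h : Dec F) (hH : Dec H) (hH' : Dec H')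
    (hP : ∀ u, HasDerivAt P (P' u) u) (hP' : Continuous P')
    (hd : ∀ x y z, HasDerivAt (fun t => H x y t) (H' x y z) z) :
    Integrable (fun p : ℝ × ℝ × ℝ => H p.1 p.2.1 p.2.2 *
      (P' (U3 F p.1 p.2.1 p.2.2) * (F p.1 p.2.1 p.2.2 / M2 F p.1 p.2.1))) ∧
    Integrable (fun p : ℝ × ℝ × ℝ => H' p.1 p.2.1 p.2.2 * P (U3 F p.1 p.2.1 p.2.2)) ∧
    ∫ p : ℝ × ℝ × ℝ, H p.1 p.2.1 p.2.2 *
      (P' (U3 F p.1 p.2.1 p.2.2) * (F p.1 p.2.1 p.2.2 / M2 F p.1 p.2.1)) =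
    - ∫ p : ℝ × ℝ × ℝ, H' p.1 p.2.1 p.2.2 * P (U3 F p.1 p.2.1 p.2.2) := by
  obtain ⟨b, hb, hb'⟩ := hH.rot.bd
  refine transfer mp3 me3 ?_
  exact ibp_param (Y := ℝ × ℝ) (μ := volume) (ρ := fun t q => F q.1 q.2 t / M2 F q.1 q.2)
    (h := fun x q => H q.1 q.2 x) (h' := fun x q => H' q.1 q.2 x) (b := b)
    (fun x q => div_nonneg (h0 _ _ x) (M2_nonneg h0 _ _))
    (fun q => (cont3 h q.1 q.2).div_const _) (fun q => (h.rot.slice q.1 q.2).div_const _)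
    (fun _ => nmass) hP hP' (fun x q => hd q.1 q.2 x) (fun q => hH.rot.slice _ _)
    (fun q => hH'.rot.slice _ _) hH'.rot.integrable
    (h.rot.1.measurable.div ((M2_dec h).1.measurable.comp measurable_snd))
    hH.rot.1.measurable
    ((U3_meas h).comp (by fun_prop : Measurable fun p : ℝ × ℝ × ℝ => (p.2.1, p.2.2, p.1))) hb' hb

end
end GN

namespace GN

def QQ (s : ℝ) : ℝ := 1/1*s^1 + 1/1*s^3 + 3/4*s^5 + 5/14*s^7 + 5/48*s^9 + 3/176*s^11 + 1/832*s^13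
def RR (s : ℝ) : ℝ := 1/3*s^3 + 2/5*s^5 + 5/14*s^7 + 31/126*s^9 + 499/3696*s^11 + 719/12012*s^13 + 35909/1681680*s^15 + 4919/816816*s^17 + 57263/43819776*s^19 + 565/2690688*s^21 + 1307/55570944*s^23 + 3/1830400*s^25 + 1/18690048*s^27
def PP (u : ℝ) : ℝ := QQ (2 * u - 1) / 2
def pp (u : ℝ) : ℝ := 1 + (2 * u - 1) ^ 2 / 2

lemma QQ_deriv (s : ℝ) : HasDerivAt QQ ((1 + s ^ 2 / 2) ^ 6) s := by
  have h : DifferentiableAt ℝ QQ s := by unfold QQ; fun_prop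
  refine h.hasDerivAt.congr_deriv ?_
  have e : QQ = fun s => 1/1*s^1 + 1/1*s^3 + 3/4*s^5 + 5/14*s^7 + 5/48*s^9 + 3/176*s^11 + 1/832*s^13 := rfl
  rw [e]
  simp (disch := fun_prop) only [deriv_fun_add, deriv_const_mul, deriv_pow_field]
  norm_num
  ring

lemma RR_deriv (s : ℝ) : HasDerivAt RR (QQ s ^ 2) s := by
  have h : DifferentiableAt ℝ RR s := by unfold RR; fun_prop
  refine h.hasDerivAt.congr_deriv ?_
  have e : RR = fun s => 1/3*s^3 + 2/5*s^5 + 5/14*s^7 + 31/126*s^9 + 499/3696*s^11 + 719/12012*s^13 + 35909/1681680*s^15 + 4919/816816*s^17 + 57263/43819776*s^19 + 565/2690688*s^21 + 1307/55570944*s^23 + 3/1830400*s^25 + 1/18690048*s^27 := rfl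
  rw [e]
  simp (disch := fun_prop) only [deriv_fun_add, deriv_const_mul, deriv_pow_field]
  unfold QQ
  norm_num
  ring

lemma aff_deriv (u : ℝ) : HasDerivAt (fun u : ℝ => 2 * u - 1) 2 u := by
  simpa using ((hasDerivAt_id u).const_mul 2).sub_const 1

lemma PP_deriv (u : ℝ) : HasDerivAt PP (pp u ^ 6) u := by
  have := ((QQ_deriv (2 * u - 1)).comp u (aff_deriv u)).div_const 2
  unfold PP pp
  refine this.congr_deriv ?_
  ring

lemma PP_cont : Continuous PP :=
  continuous_iff_continuousAt.2 fun u => (PP_deriv u).continuousAt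

lemma pp_cont : Continuous pp := by unfold pp; fun_prop

lemma pp_int : ∫ u in (0:ℝ)..1, pp u = 7 / 6 := by
  have h : ∀ u ∈ Set.uIcc (0:ℝ) 1, HasDerivAt (fun u : ℝ => u + (2 * u - 1) ^ 3 / 12) (pp u) u := by
    intro u _
    have := (hasDerivAt_id u).add (((aff_deriv u).pow 3).div_const 12)
    refine this.congr_deriv ?_
    unfold pp; norm_num; ring
  rw [intervalIntegral.integral_eq_sub_of_hasDerivAt h (pp_cont.intervalIntegrable _ _)]
  norm_num

lemma PP_int : ∫ u in (0:ℝ)..1, PP u ^ 2 = RR 1 / 4 := by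
  have h : ∀ u ∈ Set.uIcc (0:ℝ) 1, HasDerivAt (fun u : ℝ => RR (2 * u - 1) / 8) (PP u ^ 2) u := by
    intro u _
    have := ((RR_deriv (2 * u - 1)).comp u (aff_deriv u)).div_const 8
    refine this.congr_deriv ?_
    unfold PP; ring
  rw [intervalIntegral.integral_eq_sub_of_hasDerivAt h ((PP_cont.pow 2).intervalIntegrable _ _)]
  unfold RR; norm_num

def sg : ℝ := ∫ u in (0:ℝ)..1, PP u ^ 2

lemma sg_nonneg : 0 ≤ sg := intervalIntegral.integral_nonneg zero_le_one fun u _ => sq_nonneg _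

lemma sg_num : (25 * sg / 12) ^ 3 * (4 * π ^ 4) ≤ (7 / 6) ^ 36 := by
  have h1 : sg ≤ 391 / 1000 := by
    unfold sg; rw [PP_int]; unfold RR; norm_num
  have hp : π ^ 4 ≤ 3.15 ^ 4 := by
    gcongr; exact pi_lt_d2.le
  have := sg_nonneg
  calc (25 * sg / 12) ^ 3 * (4 * π ^ 4) ≤ (25 * (391 / 1000) / 12) ^ 3 * (4 * 3.15 ^ 4) := by gcongr
    _ ≤ _ := by norm_num

end GN

namespace GN

lemma cs_pt {F g a b c x y z k : ℝ} (hF : 0 ≤ F) (hg : 0 ≤ g) (hk : 0 < k)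
    (h : a ^ 2 + b ^ 2 + c ^ 2 ≤ (25 / 4) * (F * g)) :
    2 * (-(2 / 5) * (a * x + b * y + c * z)) ≤ g / k + k * (F * (x ^ 2 + y ^ 2 + z ^ 2)) := by
  have h1 : (a * x + b * y + c * z) ^ 2 ≤ (a ^ 2 + b ^ 2 + c ^ 2) * (x ^ 2 + y ^ 2 + z ^ 2) := by
    nlinarith [sq_nonneg (a * y - b * x), sq_nonneg (a * z - c * x), sq_nonneg (b * z - c * y)]
  set n := x ^ 2 + y ^ 2 + z ^ 2 with hn
  have hn0 : 0 ≤ n := by positivity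
  have h2 : (a * x + b * y + c * z) ^ 2 ≤ (25 / 4) * (F * g) * n :=
    h1.trans (mul_le_mul_of_nonneg_right h hn0)
  have hr : 0 ≤ g / k + k * (F * n) := by positivity
  refine (abs_le.1 (abs_le_of_sq_le_sq ?_ hr)).2
  have e : g / k * (k * (F * n)) = g * F * n := by field_simp
  nlinarith [sq_nonneg (g / k - k * (F * n))]

theorem gn_abs {F H H1 H2 H3 q g : ℝ → ℝ → ℝ → ℝ}
    (dF : Dec F) (dH : Dec H) (d1 : Dec H1) (d2 : Dec H2) (d3 : Dec H3) (dq : Dec q) (dg : Dec g)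
    (F0 : ∀ x y z, 0 ≤ F x y z) (H0 : ∀ x y z, 0 ≤ H x y z)
    (q0 : ∀ x y z, 0 ≤ q x y z) (g0 : ∀ x y z, 0 ≤ g x y z)
    (e2 : ∀ x y z, H x y z ^ 2 = F x y z * q x y z)
    (e6 : ∀ x y z, H x y z ^ 6 = F x y z ^ 5)
    (hd1 : ∀ x y z, HasDerivAt (fun t => H t y z) (H1 x y z) x)
    (hd2 : ∀ x y z, HasDerivAt (fun t => H x t z) (H2 x y z) y)
    (hd3 : ∀ x y z, HasDerivAt (fun t => H x y t) (H3 x y z) z)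
    (hg : ∀ x y z, H1 x y z ^ 2 + H2 x y z ^ 2 + H3 x y z ^ 2 ≤ (25 / 4) * (F x y z * g x y z)) :
    4 * π ^ 4 * (∫ p : ℝ × ℝ × ℝ, F p.1 p.2.1 p.2.2) ^ 4 ≤
      (∫ p : ℝ × ℝ × ℝ, q p.1 p.2.1 p.2.2) ^ 3 * (∫ p : ℝ × ℝ × ℝ, g p.1 p.2.1 p.2.2) ^ 3 := by
  rw [← M0_eq dF]
  set M := M0 F with hM
  set B := ∫ p : ℝ × ℝ × ℝ, q p.1 p.2.1 p.2.2 with hB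
  set A := ∫ p : ℝ × ℝ × ℝ, g p.1 p.2.1 p.2.2 with hA
  have M00 : 0 ≤ M := M0_nonneg F0
  have B00 : 0 ≤ B := integral_nonneg fun p => q0 _ _ _
  have A00 : 0 ≤ A := integral_nonneg fun p => g0 _ _ _
  rcases M00.eq_or_lt with hM0 | hMpos
  · rw [← hM0]; simp; positivity
  obtain ⟨m, hm, hm6⟩ : ∃ m : ℝ, 0 < m ∧ m ^ 6 = M :=
    ⟨M ^ (1 / 6 : ℝ), by positivity, by
      rw [← Real.rpow_natCast, ← Real.rpow_mul M00]; norm_num⟩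
  have pc6 : Continuous (fun u => pp u ^ 6) := pp_cont.pow 6
  obtain ⟨i1, j1, k1⟩ := ibp1 F0 dF dH d1 PP_deriv pc6 hd1
  obtain ⟨i2, j2, k2⟩ := ibp2 F0 dF dH d2 PP_deriv pc6 hd2
  obtain ⟨i3, j3, k3⟩ := ibp3 F0 dF dH d3 PP_deriv pc6 hd3
  set J1 := ∫ p : ℝ × ℝ × ℝ, H1 p.1 p.2.1 p.2.2 * PP (U1 F p.1) with hJ1
  set J2 := ∫ p : ℝ × ℝ × ℝ, H2 p.1 p.2.1 p.2.2 * PP (U2 F p.1 p.2.1) with hJ2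
  set J3 := ∫ p : ℝ × ℝ × ℝ, H3 p.1 p.2.1 p.2.2 * PP (U3 F p.1 p.2.1 p.2.2) with hJ3
  set h := ∫ p : ℝ × ℝ × ℝ, H p.1 p.2.1 p.2.2 with hh
  have hI := integral_psi F0 dF pp_cont pp_cont pp_cont
  have hIi := integrable_psi F0 dF pp_cont pp_cont pp_cont
  rw [pp_int] at hI
  -- main inequality
  have main : ∀ s : ℝ, 0 < s →
      s * m ^ 5 * (7 / 6) ^ 3 ≤ h / 2 - s ^ 2 / 6 * (J1 + J2 + J3) := by
    intro s hs
    have hpt : ∀ p : ℝ × ℝ × ℝ, s / m * (F p.1 p.2.1 p.2.2 *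
      (pp (U1 F p.1) * (pp (U2 F p.1 p.2.1) * pp (U3 F p.1 p.2.1 p.2.2)))) ≤
      1 / 2 * H p.1 p.2.1 p.2.2 + s ^ 2 / 6 *
        (H p.1 p.2.1 p.2.2 * (pp (U1 F p.1) ^ 6 * (M1 F p.1 / M0 F)) +
        H p.1 p.2.1 p.2.2 * (pp (U2 F p.1 p.2.1) ^ 6 * (M2 F p.1 p.2.1 / M1 F p.1)) +
        H p.1 p.2.1 p.2.2 * (pp (U3 F p.1 p.2.1 p.2.2) ^ 6 * (F p.1 p.2.1 p.2.2 / M2 F p.1 p.2.1))) := by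
      rintro ⟨x, y, z⟩
      have hr := prod_rho F0 dF x y z
      have r1 : 0 ≤ M1 F x / M0 F := div_nonneg (M1_nonneg F0 x) (M0_nonneg F0)
      have r2 : 0 ≤ M2 F x y / M1 F x := div_nonneg (M2_nonneg F0 x y) (M1_nonneg F0 x)
      have r3 : 0 ≤ F x y z / M2 F x y := div_nonneg (F0 x y z) (M2_nonneg F0 x y)
      have q6 := e6 x y z
      have ppos : ∀ u, 0 ≤ pp u := fun u => by unfold pp; positivity
      have p1 := ppos (U1 F x)
      have p2 := ppos (U2 F x y)
      have p3 := ppos (U3 F x y z)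
      have f0 := F0 x y z
      have hh0 := H0 x y z
      simp only
      generalize M1 F x / M0 F = ρ1 at *
      generalize M2 F x y / M1 F x = ρ2 at *
      generalize F x y z / M2 F x y = ρ3 at *
      generalize pp (U1 F x) = a1 at *
      generalize pp (U2 F x y) = a2 at *
      generalize pp (U3 F x y z) = a3 at *
      generalize F x y z = f at *
      generalize H x y z = h at *
      have := amgm6 (G := s / m * (f * (a1 * (a2 * a3)))) (H := h) (a := s ^ 2 * (a1 ^ 6 * ρ1))
        (b := s ^ 2 * (a2 ^ 6 * ρ2)) (c := s ^ 2 * (a3 ^ 6 * ρ3))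
        (by positivity) hh0 (by positivity) (by positivity) (by positivity) (by
          rw [q6]
          have : (s ^ 2 * (a1 ^ 6 * ρ1)) * (s ^ 2 * (a2 ^ 6 * ρ2)) * (s ^ 2 * (a3 ^ 6 * ρ3)) =
            s ^ 6 * (a1 * a2 * a3) ^ 6 * (ρ1 * ρ2 * ρ3) := by ring
          rw [this, hr, ← hM, ← hm6]
          field_simp)
      linarith
    have hintg := integral_mono (hIi.const_mul (s / m)) ((dH.integrable.const_mul (1 / 2)).add
      (((i1.add i2).add i3).const_mul (s ^ 2 / 6))) hpt
    rw [integral_add' (dH.integrable.const_mul (1 / 2)) (((i1.add i2).add i3).const_mul (s ^ 2 / 6)),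
      integral_const_mul, integral_const_mul, integral_const_mul, integral_add' (i1.add i2) i3,
      integral_add' i1 i2, k1, k2, k3, hI] at hintg
    have e : s / m * (M0 F * (7 / 6 * (7 / 6 * (7 / 6)))) = s * m ^ 5 * (7 / 6) ^ 3 := by
      rw [← hM, ← hm6]; field_simp
    rw [e] at hintg
    linarith
  -- bound on h
  have hh1 : h ≤ √B * √M := by
    refine amgm_opt B00 M00 fun k hk => ?_
    have hpt : ∀ p : ℝ × ℝ × ℝ, 2 * H p.1 p.2.1 p.2.2 ≤
        k⁻¹ * q p.1 p.2.1 p.2.2 + k * F p.1 p.2.1 p.2.2 := by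
      rintro ⟨x, y, z⟩
      simp only
      have := e2 x y z
      have f0 := F0 x y z
      have q0 := q0 x y z
      have hr : 0 ≤ k⁻¹ * q x y z + k * F x y z := by positivity
      refine (abs_le.1 (abs_le_of_sq_le_sq ?_ hr)).2
      have e : k⁻¹ * q x y z * (k * F x y z) = F x y z * q x y z := by field_simp
      nlinarith [sq_nonneg (k⁻¹ * q x y z - k * F x y z)]
    have hintg := integral_mono (dH.integrable.const_mul 2) ((dq.integrable.const_mul k⁻¹).add
      (dF.integrable.const_mul k)) hpt
    rw [integral_add' (dq.integrable.const_mul k⁻¹) (dF.integrable.const_mul k),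
      integral_const_mul, integral_const_mul, integral_const_mul, ← M0_eq dF] at hintg
    rw [div_eq_inv_mul]; exact hintg
  -- bound on J
  have one : Continuous (fun _ : ℝ => (1:ℝ)) := continuous_const
  have P2c : Continuous (fun u => PP u ^ 2) := PP_cont.pow 2
  have s1 := integral_psi F0 dF P2c one one
  have s2 := integral_psi F0 dF one P2c one
  have s3 := integral_psi F0 dF one one P2c
  have t1 := integrable_psi F0 dF P2c one one
  have t2 := integrable_psi F0 dF one P2c one
  have t3 := integrable_psi F0 dF one one P2c
  have hJ : -(2 / 5) * (J1 + J2 + J3) ≤ √A * √(3 * sg * M) := by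
    have sg0 := sg_nonneg
    refine amgm_opt A00 (by positivity) fun k hk => ?_
    have hintg := integral_mono (((j1.add j2).add j3).const_mul (-(4 / 5)))
      ((dg.integrable.const_mul k⁻¹).add (((t1.add t2).add t3).const_mul k)) (by
      rintro ⟨x, y, z⟩
      simp only [Pi.add_apply]
      have := cs_pt (x := PP (U1 F x)) (y := PP (U2 F x y)) (z := PP (U3 F x y z))
        (F0 x y z) (g0 x y z) hk (hg x y z)
      rw [div_eq_inv_mul (g x y z) k] at this
      linarith)
    rw [integral_add' (dg.integrable.const_mul k⁻¹) (((t1.add t2).add t3).const_mul k),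
      integral_const_mul, integral_const_mul, integral_const_mul, integral_add' (t1.add t2) t3,
      integral_add' t1 t2, integral_add' (j1.add j2) j3, integral_add' j1 j2, s1, s2, s3] at hintg
    simp only [intervalIntegral.integral_const, sub_zero, smul_eq_mul, mul_one, one_mul] at hintg
    change _ ≤ k⁻¹ * A + k * (M * sg + M * sg + M * sg) at hintg
    change -(4 / 5) * (J1 + J2 + J3) ≤ _ at hintg
    rw [div_eq_inv_mul A k]
    linarith
  -- combine
  set a3 : ℝ := (7 / 6) ^ 3 with ha3
  have sg0 := sg_nonneg
  have sM : √M = m ^ 3 := by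
    rw [← hm6, show m ^ 6 = (m ^ 3) ^ 2 by ring]; exact Real.sqrt_sq (by positivity)
  have sM2 : √(3 * sg * M) = √(3 * sg) * m ^ 3 := by rw [Real.sqrt_mul (by positivity), sM]
  rw [sM] at hh1
  rw [sM2] at hJ
  have fin : m ^ 2 * a3 ≤ √(√B) * √(5 / 6 * (√A * √(3 * sg))) := by
    refine amgm_opt (by positivity) (by positivity) fun s hs => ?_
    have h1 := main s hs
    have h2 : s * m ^ 5 * a3 ≤ √B * m ^ 3 / 2 + s ^ 2 / 6 * (5 / 2 * (√A * (√(3 * sg) * m ^ 3))) := by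
      have : s ^ 2 / 6 * (-(J1 + J2 + J3)) ≤ s ^ 2 / 6 * (5 / 2 * (√A * (√(3 * sg) * m ^ 3))) := by
        gcongr; linarith
      linarith
    have h3 : (s * m ^ 3 / 2) * (2 * (m ^ 2 * a3)) ≤
        (s * m ^ 3 / 2) * (√B / s + s * (5 / 6 * (√A * √(3 * sg)))) := by
      have e : (s * m ^ 3 / 2) * (√B / s + s * (5 / 6 * (√A * √(3 * sg)))) =
        √B * m ^ 3 / 2 + s ^ 2 / 6 * (5 / 2 * (√A * (√(3 * sg) * m ^ 3))) := by
        field_simp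
      rw [e]; linarith
    exact le_of_mul_le_mul_left h3 (by positivity)
  have fin12 : (m ^ 2 * a3) ^ 12 ≤ (√(√B) * √(5 / 6 * (√A * √(3 * sg)))) ^ 12 := by gcongr
  have e1 : (√(√B) * √(5 / 6 * (√A * √(3 * sg)))) ^ 12 = B ^ 3 * ((25 * sg / 12) ^ 3 * A ^ 3) := by
    have : (√(√B) * √(5 / 6 * (√A * √(3 * sg)))) ^ 12 =
      (((√(√B)) ^ 2) ^ 2) ^ 3 * (((√(5 / 6 * (√A * √(3 * sg)))) ^ 2) ^ 2) ^ 3 := by ring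
    rw [this, Real.sq_sqrt (by positivity), Real.sq_sqrt (by positivity), Real.sq_sqrt (by positivity),
      mul_pow, mul_pow (√A), Real.sq_sqrt (by positivity), Real.sq_sqrt (by positivity)]
    ring
  rw [e1, show (m ^ 2 * a3) ^ 12 = (m ^ 6) ^ 4 * (7 / 6) ^ 36 by rw [ha3]; ring, hm6] at fin12
  have num := sg_num
  have hBA : 0 ≤ B ^ 3 * A ^ 3 := by positivity
  have f1 : 4 * π ^ 4 * M ^ 4 * (7 / 6) ^ 36 ≤ B ^ 3 * A ^ 3 * (7 / 6) ^ 36 := by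
    calc 4 * π ^ 4 * M ^ 4 * (7 / 6) ^ 36 = 4 * π ^ 4 * (M ^ 4 * (7 / 6) ^ 36) := by ring
      _ ≤ 4 * π ^ 4 * (B ^ 3 * ((25 * sg / 12) ^ 3 * A ^ 3)) := by gcongr
      _ = B ^ 3 * A ^ 3 * ((25 * sg / 12) ^ 3 * (4 * π ^ 4)) := by ring
      _ ≤ _ := by gcongr
  exact le_of_mul_le_mul_right f1 (by positivity)

end GN

namespace GN

def em (p : ℝ × ℝ × ℝ) : E3 := !₂[p.1, p.2.1, p.2.2]

def emE : (ℝ × ℝ × ℝ) ≃ᵐ E3 :=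
  ((MeasurableEquiv.prodCongr (MeasurableEquiv.refl ℝ) (MeasurableEquiv.finTwoArrow (α := ℝ)).symm).trans
    (MeasurableEquiv.piFinSuccAbove (fun _ : Fin 3 => ℝ) 0).symm).trans (MeasurableEquiv.toLp 2 (Fin 3 → ℝ))

lemma emE_eq : ⇑emE = em := by
  funext p
  obtain ⟨x, y, z⟩ := p
  unfold emE em
  ext i
  fin_cases i <;> simp [MeasurableEquiv.piFinSuccAbove, MeasurableEquiv.finTwoArrow, MeasurableEquiv.piFinTwo, MeasurableEquiv.prodCongr]

lemma em_emb : MeasurableEmbedding em := emE_eq ▸ emE.measurableEmbedding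

lemma em_mp : MeasurePreserving em := by
  rw [← emE_eq]
  have h1 : MeasurePreserving (MeasurableEquiv.finTwoArrow (α := ℝ)).symm :=
    (volume_preserving_finTwoArrow ℝ).symm
  have h2 : MeasurePreserving (MeasurableEquiv.piFinSuccAbove (fun _ : Fin 3 => ℝ) 0).symm :=
    (volume_preserving_piFinSuccAbove (fun _ : Fin 3 => ℝ) 0).symm
  have h3 : MeasurePreserving (MeasurableEquiv.toLp 2 (Fin 3 → ℝ)) :=
    (EuclideanSpace.volume_preserving_symm_measurableEquiv_toLp (Fin 3)).symm
  have h0 := (MeasurePreserving.id (volume : Measure ℝ)).prod h1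
  exact (h3.comp h2).comp h0

lemma em_int (G : E3 → ℝ) : ∫ p, G (em p) = ∫ x, G x := em_mp.integral_comp em_emb G

lemma em_cont : Continuous em := by
  unfold em
  fun_prop

lemma em_deriv0 (x y z : ℝ) : HasDerivAt (fun t => em (t, y, z)) (ee 0) x := by
  have : (fun t => em (t, y, z)) = fun t => em (x, y, z) + (t - x) • ee 0 := by
    funext t; ext i; fin_cases i <;> simp [em, ee]
  rw [this]
  simpa using (((hasDerivAt_id x).sub_const x).smul_const (ee 0)).const_add (em (x, y, z))
lemma em_deriv1 (x y z : ℝ) : HasDerivAt (fun t => em (x, t, z)) (ee 1) y := by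
  have : (fun t => em (x, t, z)) = fun t => em (x, y, z) + (t - y) • ee 1 := by
    funext t; ext i; fin_cases i <;> simp [em, ee]
  rw [this]
  simpa using (((hasDerivAt_id y).sub_const y).smul_const (ee 1)).const_add (em (x, y, z))
lemma em_deriv2 (x y z : ℝ) : HasDerivAt (fun t => em (x, y, t)) (ee 2) z := by
  have : (fun t => em (x, y, t)) = fun t => em (x, y, z) + (t - z) • ee 2 := by
    funext t; ext i; fin_cases i <;> simp [em, ee]
  rw [this]
  simpa using (((hasDerivAt_id z).sub_const z).smul_const (ee 2)).const_add (em (x, y, z))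

def DecE (G : E3 → ℝ) : Prop :=
  Continuous G ∧ ∃ C, 0 ≤ C ∧ ∀ x : E3, |G x| ≤ C * (rr (x 0) * rr (x 1) * rr (x 2))

lemma DecE.dec {G : E3 → ℝ} (h : DecE G) : Dec (fun x y z => G (em (x, y, z))) := by
  obtain ⟨hc, C, hC, hb⟩ := h
  exact ⟨hc.comp em_cont, C, hC, fun x y z => by simpa [em] using hb (em (x, y, z))⟩

lemma DecE.add {G K : E3 → ℝ} (h : DecE G) (k : DecE K) : DecE (fun x => G x + K x) := by
  obtain ⟨hc, C, hC, hb⟩ := h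
  obtain ⟨kc, D, hD, kb⟩ := k
  refine ⟨hc.add kc, C + D, by positivity, fun x => (abs_add_le _ _).trans ?_⟩
  rw [add_mul]; exact add_le_add (hb x) (kb x)

lemma DecE.sum {ι : Type*} {s : Finset ι} {G : ι → E3 → ℝ} (h : ∀ i, DecE (G i)) :
    DecE (fun x => ∑ i ∈ s, G i x) := by
  classical
  induction s using Finset.induction with
  | empty => exact ⟨by simpa using continuous_const, 0, le_rfl, by simp⟩
  | insert a s ha ih => simp only [Finset.sum_insert ha]; exact (h a).add ih

lemma DecE.bdd {G : E3 → ℝ} (h : DecE G) : ∃ C, 0 ≤ C ∧ ∀ x, |G x| ≤ C := by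
  obtain ⟨hc, C, hC, hb⟩ := h
  refine ⟨C, hC, fun x => (hb x).trans ?_⟩
  have h0 := rr_le_one (x 0); have h1 := rr_le_one (x 1); have h2 := rr_le_one (x 2)
  have p0 := (rr_pos (x 0)).le; have p1 := (rr_pos (x 1)).le; have p2 := (rr_pos (x 2)).le
  have : rr (x 0) * rr (x 1) * rr (x 2) ≤ 1 :=
    mul_le_one₀ (mul_le_one₀ h0 p1 h1) p2 h2
  nlinarith

lemma DecE.mul_bdd {G K : E3 → ℝ} (h : DecE G) (kc : Continuous K) {D : ℝ} (hD : 0 ≤ D)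
    (kb : ∀ x, |K x| ≤ D) : DecE (fun x => K x * G x) := by
  obtain ⟨hc, C, hC, hb⟩ := h
  refine ⟨kc.mul hc, D * C, by positivity, fun x => ?_⟩
  rw [abs_mul, mul_assoc]
  exact mul_le_mul (kb x) (hb x) (abs_nonneg _) hD

lemma DecE.mul {G K : E3 → ℝ} (h : DecE G) (k : DecE K) : DecE (fun x => K x * G x) := by
  obtain ⟨D, hD, kb⟩ := k.bdd
  exact h.mul_bdd k.1 hD kb

lemma DecE.integrable {G : E3 → ℝ} (h : DecE G) : Integrable G :=
  (em_mp.integrable_comp_emb em_emb).1 h.dec.integrable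

lemma DecE.schwartz (f : 𝓢(E3, ℝ)) : DecE f := by
  obtain ⟨C, hC⟩ := f.decay 0 0
  obtain ⟨D, hD⟩ := f.decay 6 0
  refine ⟨f.continuous, 4 * (max C 0 + max D 0), by positivity, fun x => ?_⟩
  have h1 := hC.2 x
  have h2 := hD.2 x
  simp only [pow_zero, one_mul, norm_iteratedFDeriv_zero, Real.norm_eq_abs] at h1 h2
  have hn : ‖x‖ ^ 2 = x 0 ^ 2 + x 1 ^ 2 + x 2 ^ 2 := by
    rw [EuclideanSpace.real_norm_sq_eq, Fin.sum_univ_three]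
  have hw : rr (x 0) * rr (x 1) * rr (x 2) =
      ((1 + x 0 ^ 2) * (1 + x 1 ^ 2) * (1 + x 2 ^ 2))⁻¹ := by
    unfold rr; rw [mul_inv, mul_inv]
  rw [hw, ← div_eq_mul_inv, le_div_iff₀ (by positivity)]
  have hb : (1 + x 0 ^ 2) * (1 + x 1 ^ 2) * (1 + x 2 ^ 2) ≤ 4 * (1 + ‖x‖ ^ 6) := by
    have e : (1 + x 0 ^ 2) * (1 + x 1 ^ 2) * (1 + x 2 ^ 2) ≤ (1 + ‖x‖ ^ 2) ^ 3 := by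
      have a0 : 1 + x 0 ^ 2 ≤ 1 + ‖x‖ ^ 2 := by nlinarith [sq_nonneg (x 1), sq_nonneg (x 2)]
      have a1 : 1 + x 1 ^ 2 ≤ 1 + ‖x‖ ^ 2 := by nlinarith [sq_nonneg (x 0), sq_nonneg (x 2)]
      have a2 : 1 + x 2 ^ 2 ≤ 1 + ‖x‖ ^ 2 := by nlinarith [sq_nonneg (x 0), sq_nonneg (x 1)]
      calc _ ≤ (1 + ‖x‖ ^ 2) * (1 + ‖x‖ ^ 2) * (1 + ‖x‖ ^ 2) := by gcongr
        _ = _ := by ring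
    refine e.trans ?_
    have : 0 ≤ ‖x‖ ^ 2 := by positivity
    have h6 : ‖x‖ ^ 6 = (‖x‖ ^ 2) ^ 3 := by ring
    rw [h6]
    nlinarith [mul_nonneg (sq_nonneg (1 - ‖x‖ ^ 2)) (by positivity : 0 ≤ 1 + ‖x‖ ^ 2)]
  calc |f x| * _ ≤ |f x| * (4 * (1 + ‖x‖ ^ 6)) := by gcongr
    _ = 4 * (|f x| + ‖x‖ ^ 6 * |f x|) := by ring
    _ ≤ _ := by
      have := le_max_left C 0
      have := le_max_left D 0
      linarith

lemma pd_schwartz (f : 𝓢(E3, ℝ)) (i : Fin 3) :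
    pd i f = ⇑(LineDeriv.lineDerivOp (ee i) f : 𝓢(E3, ℝ)) := by
  funext x
  rw [SchwartzMap.lineDerivOp_apply_eq_fderiv]; rfl

lemma pd_along (f : 𝓢(E3, ℝ)) (i : Fin 3) {c : ℝ → E3} {t : ℝ} (hc : HasDerivAt c (ee i) t) :
    HasDerivAt (fun s => f (c s)) (pd i f (c t)) t :=
  (f.differentiableAt (x := c t)).hasFDerivAt.comp_hasDerivAt t hc

lemma q_along {ι : Type*} [Fintype ι] (f : ι → 𝓢(E3, ℝ)) (i : Fin 3) {c : ℝ → E3} {t : ℝ}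
    (hc : HasDerivAt c (ee i) t) :
    HasDerivAt (fun s => (∑ a, f a (c s) ^ 2) ^ (5 / 4 : ℝ))
      ((5 / 2) * ((∑ a, f a (c t) ^ 2) ^ (1 / 4 : ℝ) * ∑ a, f a (c t) * pd i (f a) (c t))) t := by
  have h1 : HasDerivAt (fun s => ∑ a, f a (c s) ^ 2) (∑ a, 2 * (f a (c t) * pd i (f a) (c t))) t := by
    refine HasDerivAt.fun_sum fun a _ => ?_
    refine ((pd_along (f a) i hc).pow 2).congr_deriv ?_
    norm_num; ring
  refine (h1.rpow_const (p := 5 / 4) (Or.inr (by norm_num))).congr_deriv ?_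
  rw [← Finset.mul_sum]
  norm_num; ring

theorem gn_E3 {ι : Type*} [Fintype ι] (f : ι → 𝓢(E3, ℝ)) :
    4 * π ^ 4 * (∫ x, (∑ a, f a x ^ 2) ^ (3 / 2 : ℝ)) ^ 4 ≤
      (∫ x, ∑ a, f a x ^ 2) ^ 3 * (∫ x, ∑ a, ∑ i, pd i (f a) x ^ 2) ^ 3 := by
  set q : E3 → ℝ := fun x => ∑ a, f a x ^ 2 with hq
  set g : E3 → ℝ := fun x => ∑ a, ∑ i, pd i (f a) x ^ 2 with hg
  have q0 : ∀ x, 0 ≤ q x := fun x => Finset.sum_nonneg fun a _ => sq_nonneg _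
  have g0 : ∀ x, 0 ≤ g x := fun x => Finset.sum_nonneg fun a _ => Finset.sum_nonneg fun i _ => sq_nonneg _
  have dpd : ∀ a i, DecE (pd i (f a)) := fun a i => by rw [pd_schwartz]; exact DecE.schwartz _
  have dq : DecE q := DecE.sum fun a => by
    simpa [pow_two] using (DecE.schwartz (f a)).mul (DecE.schwartz (f a))
  have dg : DecE g := DecE.sum fun a => DecE.sum fun i => by
    simpa [pow_two] using (dpd a i).mul (dpd a i)
  obtain ⟨K, hK, hqK⟩ := dq.bdd
  have pc : ∀ s : ℝ, 0 ≤ s → Continuous fun x => q x ^ s := fun s hs =>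
    dq.1.rpow_const fun x => Or.inr hs
  have pb : ∀ s : ℝ, 0 ≤ s → ∀ x, |q x ^ s| ≤ K ^ s := fun s hs x => by
    rw [abs_of_nonneg (rpow_nonneg (q0 x) s)]
    exact rpow_le_rpow (q0 x) ((le_abs_self _).trans (hqK x)) hs
  have radd : ∀ (s : ℝ) (x : E3), 0 ≤ s → q x ^ s * q x = q x ^ (s + 1) := fun s x hs => by
    rw [rpow_add_of_nonneg (q0 x) hs zero_le_one, rpow_one]
  have dF : DecE fun x => q x ^ (3 / 2 : ℝ) := by
    have := dq.mul_bdd (pc (1 / 2) (by norm_num)) (by positivity) (pb (1 / 2) (by norm_num))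
    convert this using 2 with x
    rw [radd _ x (by norm_num)]; norm_num
  have dH : DecE fun x => q x ^ (5 / 4 : ℝ) := by
    have := dq.mul_bdd (pc (1 / 4) (by norm_num)) (by positivity) (pb (1 / 4) (by norm_num))
    convert this using 2 with x
    rw [radd _ x (by norm_num)]; norm_num
  have dHi : ∀ i, DecE fun x => (5 / 2) * (q x ^ (1 / 4 : ℝ) * ∑ a, f a x * pd i (f a) x) := fun i => by
    have h1 : DecE fun x => ∑ a, f a x * pd i (f a) x :=
      DecE.sum fun a => (dpd a i).mul (DecE.schwartz (f a))
    have := h1.mul_bdd (pc (1 / 4) (by norm_num)) (by positivity) (pb (1 / 4) (by norm_num))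
    exact this.mul_bdd (K := fun _ => 5 / 2) continuous_const (D := 5 / 2) (by norm_num)
      (fun x => by rw [abs_of_nonneg (by norm_num)])
  have := gn_abs dF.dec dH.dec (dHi 0).dec (dHi 1).dec (dHi 2).dec dq.dec dg.dec
    (fun x y z => rpow_nonneg (q0 _) _) (fun x y z => rpow_nonneg (q0 _) _)
    (fun x y z => q0 _) (fun x y z => g0 _)
    (fun x y z => by
      rw [radd _ _ (by norm_num), ← rpow_natCast, ← rpow_mul (q0 _)]; norm_num)
    (fun x y z => by
      rw [← rpow_natCast, ← rpow_mul (q0 _), ← rpow_natCast, ← rpow_mul (q0 _)]; norm_num)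
    (fun x y z => q_along f 0 (em_deriv0 x y z))
    (fun x y z => q_along f 1 (em_deriv1 x y z))
    (fun x y z => q_along f 2 (em_deriv2 x y z))
    (fun x y z => by
      generalize em (x, y, z) = w
      have cs : ∀ i : Fin 3, (∑ a, f a w * pd i (f a) w) ^ 2 ≤ q w * ∑ a, pd i (f a) w ^ 2 := fun i =>
        Finset.sum_mul_sq_le_sq_mul_sq _ _ _
      have hgw : g w = ∑ a, pd 0 (f a) w ^ 2 + ∑ a, pd 1 (f a) w ^ 2 + ∑ a, pd 2 (f a) w ^ 2 := by
        simp only [hg, Fin.sum_univ_three, Finset.sum_add_distrib]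
      have r2 : (q w ^ (1 / 4 : ℝ)) ^ 2 = q w ^ (1 / 2 : ℝ) := by
        rw [← rpow_natCast, ← rpow_mul (q0 _)]; norm_num
      have r3 : q w ^ (3 / 2 : ℝ) = q w ^ (1 / 2 : ℝ) * q w := by
        rw [radd _ _ (by norm_num)]; norm_num
      have h0 : 0 ≤ q w ^ (1 / 2 : ℝ) := rpow_nonneg (q0 _) _
      simp only [mul_pow]
      rw [r2, r3, hgw]
      have c0 := mul_le_mul_of_nonneg_left (cs 0) h0
      have c1 := mul_le_mul_of_nonneg_left (cs 1) h0
      have c2 := mul_le_mul_of_nonneg_left (cs 2) h0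
      nlinarith)
  have e1 := em_int fun x => q x ^ (3 / 2 : ℝ)
  have e2 := em_int q
  have e3 := em_int g
  rw [← e1, ← e2, ← e3]
  exact this

end GN

namespace GN

def DD (i : Fin 3) (f : 𝓢(E3, ℝ)) : 𝓢(E3, ℝ) := LineDeriv.lineDerivOp (ee i) f

lemma DD_apply (i : Fin 3) (f : 𝓢(E3, ℝ)) (x : E3) : DD i f x = fderiv ℝ f x (ee i) :=
  SchwartzMap.lineDerivOp_apply_eq_fderiv _ _ _

lemma pd_DD (i : Fin 3) (f : 𝓢(E3, ℝ)) : pd i f = ⇑(DD i f) := pd_schwartz f i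

def mulS (f g : 𝓢(E3, ℝ)) : 𝓢(E3, ℝ) := SchwartzMap.pairing (ContinuousLinearMap.mul ℝ ℝ) f g

@[simp] lemma mulS_apply (f g : 𝓢(E3, ℝ)) (x : E3) : mulS f g x = f x * g x := rfl

@[simp] lemma DD_mulS (i : Fin 3) (f g : 𝓢(E3, ℝ)) (x : E3) :
    DD i (mulS f g) x = DD i f x * g x + f x * DD i g x := by
  rw [DD_apply, DD_apply, DD_apply]
  have : ⇑(mulS f g) = fun x => f x * g x := rfl
  rw [this, fderiv_fun_mul f.differentiableAt g.differentiableAt]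
  simp; ring

@[simp] lemma DD_add (i : Fin 3) (f g : 𝓢(E3, ℝ)) : DD i (f + g) = DD i f + DD i g :=
  LineDeriv.lineDerivOp_add _ _ _
@[simp] lemma DD_sub (i : Fin 3) (f g : 𝓢(E3, ℝ)) : DD i (f - g) = DD i f - DD i g := by
  ext x
  simp only [DD_apply, sub_apply]
  have : ⇑(f - g) = fun x => f x - g x := rfl
  rw [this, fderiv_fun_sub f.differentiableAt g.differentiableAt]; rfl
@[simp] lemma DD_smul (i : Fin 3) (c : ℝ) (f : 𝓢(E3, ℝ)) : DD i (c • f) = c • DD i f :=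
  LineDeriv.lineDerivOp_smul _ _ _

lemma DD_comm (i j : Fin 3) (f : 𝓢(E3, ℝ)) : DD i (DD j f) = DD j (DD i f) := by
  ext x
  have key : ∀ i j : Fin 3, DD i (DD j f) x = fderiv ℝ (fderiv ℝ f) x (ee i) (ee j) := fun i j => by
    rw [DD_apply]
    have : ⇑(DD j f) = fun y => fderiv ℝ f y (ee j) := funext fun y => DD_apply j f y
    have hd : DifferentiableAt ℝ (fderiv ℝ f) x :=
      ((f.smooth 2).contDiffAt.fderiv_right (m := 1) le_rfl).differentiableAt one_ne_zero
    rw [this, fderiv_clm_apply hd (differentiableAt_const _)]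
    simp
  rw [key, key]
  exact ((f.smooth 2).contDiffAt.isSymmSndFDerivAt (by simp)).eq _ _

def Null (φ : E3 → ℝ) : Prop := Integrable φ ∧ ∫ x, φ x = 0

lemma Null.congr {φ ψ : E3 → ℝ} (h : Null φ) (e : ∀ x, ψ x = φ x) : Null ψ := by
  rw [show ψ = φ from funext e]; exact h
lemma Null.add {φ ψ : E3 → ℝ} (h : Null φ) (k : Null ψ) : Null fun x => φ x + ψ x :=
  ⟨h.1.add k.1, by rw [integral_add h.1 k.1, h.2, k.2, add_zero]⟩
lemma Null.const_mul {φ : E3 → ℝ} (h : Null φ) (c : ℝ) : Null fun x => c * φ x :=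
  ⟨h.1.const_mul c, by rw [integral_const_mul, h.2, mul_zero]⟩

lemma Null.DD (i : Fin 3) (f : 𝓢(E3, ℝ)) : Null (DD i f) := by
  refine ⟨SchwartzMap.integrable _, ?_⟩
  have h := integral_bilinear_fderiv_right_eq_neg_left_of_integrable (μ := (volume : Measure E3))
    (B := ContinuousLinearMap.mul ℝ ℝ) (f := fun _ : E3 => (1:ℝ)) (g := f) (v := ee i)
    (by simp) (by simpa [← DD_apply] using (GN.DD i f).integrable) (by simpa using f.integrable)
    (fun x _ => by fun_prop) (fun x _ => f.differentiableAt)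
  simpa [← DD_apply] using h

lemma Null.div (h0 h1 h2 : 𝓢(E3, ℝ)) : Null fun x => GN.DD 0 h0 x + GN.DD 1 h1 x + GN.DD 2 h2 x :=
  ((Null.DD 0 h0).add (Null.DD 1 h1)).add (Null.DD 2 h2)

/-- ∫ f Δ f = - ∫ |∇ f|² -/
lemma null_lap (f : 𝓢(E3, ℝ)) :
    Null fun x => (∑ i, f x * DD i (DD i f) x) + ∑ i, DD i f x ^ 2 := by
  refine (Null.div (mulS f (DD 0 f)) (mulS f (DD 1 f)) (mulS f (DD 2 f))).congr fun x => ?_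
  simp only [Fin.sum_univ_three, DD_mulS]; ring

variable {u : Fin 3 → 𝓢(E3, ℝ)}

lemma null_adv (hu : ∑ i, DD i (u i) = 0) (f : 𝓢(E3, ℝ)) :
    Null fun x => f x * ∑ i, u i x * DD i f x := by
  have h0 : ∀ x, DD 0 (u 0) x + DD 1 (u 1) x + DD 2 (u 2) x = 0 := fun x => by
    have := congrArg (fun g : 𝓢(E3, ℝ) => g x) hu
    simpa [Fin.sum_univ_three] using this
  refine ((Null.div (mulS (u 0) (mulS f f)) (mulS (u 1) (mulS f f)) (mulS (u 2) (mulS f f))).const_mul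
    (1 / 2)).congr fun x => ?_
  simp only [Fin.sum_univ_three, DD_mulS, mulS_apply]
  linear_combination (-(1 / 2) * f x ^ 2) * h0 x

lemma null_tr2 (hu : ∑ i, DD i (u i) = 0) :
    Null fun x => ∑ i, ∑ j, DD i (u j) x * DD j (u i) x := by
  have h0 : ∀ j x, DD j (DD 0 (u 0)) x + DD j (DD 1 (u 1)) x + DD j (DD 2 (u 2)) x = 0 := fun j x => by
    have := congrArg (fun g : 𝓢(E3, ℝ) => DD j g x) hu
    have z : DD j 0 = 0 := by simpa using DD_smul j 0 0
    simpa [Fin.sum_univ_three, z] using this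
  let h (i : Fin 3) : 𝓢(E3, ℝ) :=
    mulS (u 0) (DD 0 (u i)) + mulS (u 1) (DD 1 (u i)) + mulS (u 2) (DD 2 (u i))
  refine (Null.div (h 0) (h 1) (h 2)).congr fun x => ?_
  have a0 := h0 0 x
  have a1 := h0 1 x
  have a2 := h0 2 x
  simp only [h, Fin.sum_univ_three, DD_mulS, DD_add, add_apply]
  have c : ∀ i j k, DD i (DD j (u k)) x = DD j (DD i (u k)) x := fun i j k => by rw [DD_comm]
  linear_combination -(u 0 x) * a0 - u 1 x * a1 - u 2 x * a2 + u 0 x * c 0 1 1 + u 0 x * c 0 2 2 + u 1 x * c 1 0 0 + u 1 x * c 1 2 2 + u 2 x * c 2 0 0 + u 2 x * c 2 1 1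

lemma null_det : Null fun x => Matrix.det (Matrix.of fun i j => DD i (u j) x) := by
  refine (Null.div
    (mulS (u 0) (mulS (DD 1 (u 1)) (DD 2 (u 2)) - mulS (DD 2 (u 1)) (DD 1 (u 2))))
    (mulS (u 0) (mulS (DD 2 (u 1)) (DD 0 (u 2)) - mulS (DD 0 (u 1)) (DD 2 (u 2))))
    (mulS (u 0) (mulS (DD 0 (u 1)) (DD 1 (u 2)) - mulS (DD 1 (u 1)) (DD 0 (u 2))))).congr fun x => ?_
  simp only [Matrix.det_fin_three, Matrix.of_apply, DD_mulS, DD_sub, sub_apply, mulS_apply]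
  rw [DD_comm 1 0 (u 1), DD_comm 2 0 (u 1), DD_comm 2 1 (u 1),
    DD_comm 1 0 (u 2), DD_comm 2 0 (u 2), DD_comm 2 1 (u 2)]
  ring

end GN

namespace GN

lemma det_bd {S : Matrix (Fin 3) (Fin 3) ℝ} (hs : S.IsSymm) (ht : S 0 0 + S 1 1 + S 2 2 = 0) :
    54 * S.det ^ 2 ≤ (∑ i, ∑ j, S i j ^ 2) ^ 3 := by
  have hh : S.IsHermitian := by
    rw [Matrix.IsHermitian, Matrix.conjTranspose_eq_transpose_of_trivial]; exact hs
  set l := hh.eigenvalues with hl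
  have e1 : S.det = l 0 * l 1 * l 2 := by
    rw [hh.det_eq_prod_eigenvalues, Fin.prod_univ_three]; rfl
  have e2 : S.trace = l 0 + l 1 + l 2 := by
    rw [hh.trace_eq_sum_eigenvalues, Fin.sum_univ_three]; rfl
  have e3 : (1 - S).det = (1 - l 0) * (1 - l 1) * (1 - l 2) := by
    have := congrArg (Polynomial.eval 1) hh.charpoly_eq
    rw [Matrix.eval_charpoly, Polynomial.eval_prod, Fin.prod_univ_three] at this
    simpa using this
  have s1 : S 1 0 = S 0 1 := hs.apply 0 1
  have s2 : S 2 0 = S 0 2 := hs.apply 0 2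
  have s3 : S 2 1 = S 1 2 := hs.apply 1 2
  rw [Matrix.trace_fin_three, ht] at e2
  have hq : ∑ i, ∑ j, S i j ^ 2 = l 0 ^ 2 + l 1 ^ 2 + l 2 ^ 2 := by
    have e1' := e1
    rw [Matrix.det_fin_three] at e1' e3
    simp [s1, s2, s3] at e3
    simp only [Fin.sum_univ_three, s1, s2, s3]
    rw [s1, s2, s3] at e1'
    have ht2 : (S 0 0 + S 1 1 + S 2 2) ^ 2 = 0 := by rw [ht]; ring
    have ht3 : (l 0 + l 1 + l 2) ^ 2 = 0 := by rw [← e2]; ring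
    linear_combination ht2 - ht3 - 2 * e3 - 2 * e1' - 2 * ht - 2 * e2
  rw [hq, e1]
  have : l 2 = -l 0 - l 1 := by linarith
  rw [this]
  nlinarith [sq_nonneg ((l 0 - l 1) * (2 * l 0 + l 1) * (l 0 + 2 * l 1))]

/-- final scalar inequality -/
lemma final_alg {ν E D X d M : ℝ} (hν : 0 < ν) (hE : 0 ≤ E) (hD : 0 ≤ D) (hM : 0 ≤ M)
    (hd : d = -2 * ν * D + X) (hX : 729 * X ^ 4 ≤ 64 * M ^ 4) (hGN : 4 * π ^ 4 * M ^ 4 ≤ E ^ 3 * D ^ 3) :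
    d ≤ E ^ 3 / (3456 * π ^ 4 * ν ^ 3) := by
  have hpi := Real.pi_pos
  set Z := E ^ 3 / (3456 * π ^ 4 * ν ^ 3) with hZ
  have hZ0 : 0 ≤ Z := by positivity
  set w := 2 * ν * D / 3 with hw
  have hw0 : 0 ≤ w := by positivity
  have hX4 : X ^ 4 ≤ 256 * (w ^ 3 * Z) := by
    have h1 : 729 * (4 * π ^ 4) * X ^ 4 ≤ 64 * (E ^ 3 * D ^ 3) := by
      calc 729 * (4 * π ^ 4) * X ^ 4 = 4 * π ^ 4 * (729 * X ^ 4) := by ring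
        _ ≤ 4 * π ^ 4 * (64 * M ^ 4) := by gcongr
        _ = 64 * (4 * π ^ 4 * M ^ 4) := by ring
        _ ≤ _ := by gcongr
    have h2 : 729 * (4 * π ^ 4) * (256 * (w ^ 3 * Z)) = 64 * (E ^ 3 * D ^ 3) := by
      rw [hw, hZ]; field_simp; ring
    rw [← h2] at h1
    exact le_of_mul_le_mul_left h1 (by positivity)
  have hAG : 256 * (w ^ 3 * Z) ≤ (3 * w + Z) ^ 4 := by
    nlinarith [mul_nonneg (sq_nonneg (w - Z)) (by positivity : 0 ≤ 81 * w ^ 2 + 14 * w * Z + Z ^ 2)]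
  have hX' : X ≤ 3 * w + Z := by
    by_contra hcon
    push Not at hcon
    have : (3 * w + Z) ^ 4 < X ^ 4 := by gcongr
    linarith
  rw [hd]
  have : 3 * w = 2 * ν * D := by rw [hw]; ring
  linarith

def oS (u : Fin 3 → 𝓢(E3, ℝ)) : Fin 3 → 𝓢(E3, ℝ) :=
  ![DD 1 (u 2) - DD 2 (u 1), DD 2 (u 0) - DD 0 (u 2), DD 0 (u 1) - DD 1 (u 0)]

def sS (u : Fin 3 → 𝓢(E3, ℝ)) (i j : Fin 3) : 𝓢(E3, ℝ) := (1 / 2 : ℝ) • (DD i (u j) + DD j (u i))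

lemma curl_eq (u : Fin 3 → 𝓢(E3, ℝ)) (k : Fin 3) : curl (fun i => ⇑(u i)) k = ⇑(oS u k) := by
  fin_cases k <;> (funext x; simp [curl, oS, pd_DD])

lemma strain_eq (u : Fin 3 → 𝓢(E3, ℝ)) (i j : Fin 3) :
    strain (fun i => ⇑(u i)) i j = ⇑(sS u i j) := by
  funext x; simp [strain, sS, pd_DD]; ring

variable {u : Fin 3 → 𝓢(E3, ℝ)}

lemma enst_eq (hu : ∑ i, DD i (u i) = 0) :
    ∫ x, ∑ a : Fin 3 × Fin 3, sS u a.1 a.2 x ^ 2 = (1 / 2) * ∫ x, ∑ k, oS u k x ^ 2 := by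
  have h := null_tr2 hu
  have i2 : Integrable fun x => ∑ k, oS u k x ^ 2 :=
    (DecE.sum fun k => by simpa [pow_two] using (DecE.schwartz (oS u k)).mul (DecE.schwartz (oS u k))).integrable
  have e : ∀ x, ∑ a : Fin 3 × Fin 3, sS u a.1 a.2 x ^ 2 =
      (∑ i, ∑ j, DD i (u j) x * DD j (u i) x) + (1 / 2) * ∑ k, oS u k x ^ 2 := fun x => by
    rw [Fintype.sum_prod_type]
    simp [Fin.sum_univ_three, sS, oS]
    ring
  simp only [e]
  rw [integral_add h.1 (i2.const_mul _), h.2, integral_const_mul, zero_add]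

lemma div_DD (hu : ∑ i, DD i (u i) = 0) (l : Fin 3) : ∑ i, DD i (DD l (u i)) = 0 := by
  have := congrArg (DD l) hu
  have z : DD l 0 = 0 := by simpa using DD_smul l 0 0
  simp only [Fin.sum_univ_three, DD_add, z] at this ⊢
  rw [DD_comm 0 l, DD_comm 1 l, DD_comm 2 l]; exact this

lemma spatial {ν : ℝ} (hu : ∑ i, DD i (u i) = 0) {W : Fin 3 → E3 → ℝ}
    (hW : ∀ x k, W k x = ν * (∑ i, DD i (DD i (oS u k)) x) - (∑ i, u i x * DD i (oS u k) x)
      + ∑ j, sS u k j x * oS u j x) :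
    ∫ x, ∑ k, oS u k x * W k x = -2 * ν * (∫ x, ∑ a : Fin 3 × Fin 3, ∑ i, DD i (sS u a.1 a.2) x ^ 2)
      + (-4 * ∫ x, (Matrix.of fun i j => sS u i j x).det) := by
  have h0 : ∀ x, DD 0 (u 0) x + DD 1 (u 1) x + DD 2 (u 2) x = 0 := fun x => by
    have := congrArg (fun g : 𝓢(E3, ℝ) => g x) hu
    simpa [Fin.sum_univ_three] using this
  have N1 := ((null_lap (oS u 0)).add (null_lap (oS u 1))).add (null_lap (oS u 2))
  have N2 := ((null_adv hu (oS u 0)).add (null_adv hu (oS u 1))).add (null_adv hu (oS u 2))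
  have N3 := ((null_tr2 (div_DD hu 0)).add (null_tr2 (div_DD hu 1))).add (null_tr2 (div_DD hu 2))
  have N4 := null_det (u := u)
  have N := (((N1.const_mul ν).add (N2.const_mul (-1))).add (N3.const_mul (2 * ν))).add (N4.const_mul 4)
  have iD : Integrable fun x => ∑ a : Fin 3 × Fin 3, ∑ i, DD i (sS u a.1 a.2) x ^ 2 :=
    (DecE.sum fun a => DecE.sum fun i => by
      simpa [pow_two] using (DecE.schwartz (DD i (sS u a.1 a.2))).mul (DecE.schwartz (DD i (sS u a.1 a.2)))).integrable
  have iX : Integrable fun x => (Matrix.of fun i j => sS u i j x).det := by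
    have := (mulS (sS u 0 0) (mulS (sS u 1 1) (sS u 2 2)) - mulS (sS u 0 0) (mulS (sS u 1 2) (sS u 2 1))
      - mulS (sS u 0 1) (mulS (sS u 1 0) (sS u 2 2)) + mulS (sS u 0 1) (mulS (sS u 1 2) (sS u 2 0))
      + mulS (sS u 0 2) (mulS (sS u 1 0) (sS u 2 1)) - mulS (sS u 0 2) (mulS (sS u 1 1) (sS u 2 0))).integrable (μ := volume)
    refine this.congr (Filter.Eventually.of_forall fun x => ?_)
    simp only [Matrix.det_fin_three, Matrix.of_apply, mulS_apply, sub_apply, add_apply]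
    ring
  have e : ∀ x, ∑ k, oS u k x * W k x =
      (ν * ((∑ i, oS u 0 x * DD i (DD i (oS u 0)) x + ∑ i, DD i (oS u 0) x ^ 2) +
        (∑ i, oS u 1 x * DD i (DD i (oS u 1)) x + ∑ i, DD i (oS u 1) x ^ 2) +
        (∑ i, oS u 2 x * DD i (DD i (oS u 2)) x + ∑ i, DD i (oS u 2) x ^ 2)) +
      (-1) * (oS u 0 x * ∑ i, u i x * DD i (oS u 0) x + oS u 1 x * ∑ i, u i x * DD i (oS u 1) x +
        oS u 2 x * ∑ i, u i x * DD i (oS u 2) x) +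
      (2 * ν) * ((∑ i, ∑ j, DD i (DD 0 (u j)) x * DD j (DD 0 (u i)) x) +
        (∑ i, ∑ j, DD i (DD 1 (u j)) x * DD j (DD 1 (u i)) x) +
        (∑ i, ∑ j, DD i (DD 2 (u j)) x * DD j (DD 2 (u i)) x)) +
      4 * (Matrix.of fun i j => DD i (u j) x).det) +
      ((-2 * ν) * (∑ a : Fin 3 × Fin 3, ∑ i, DD i (sS u a.1 a.2) x ^ 2) +
        (-4) * (Matrix.of fun i j => sS u i j x).det) := by
    intro x
    have A : ∑ k, oS u k x * ∑ j, sS u k j x * oS u j x + 4 * (Matrix.of fun i j => sS u i j x).det =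
        4 * (Matrix.of fun i j => DD i (u j) x).det := by
      simp only [Matrix.det_fin_three, Matrix.of_apply, Fin.sum_univ_three]
      simp [sS, oS]
      have h2 : DD 2 (u 2) x = - DD 0 (u 0) x - DD 1 (u 1) x := by linarith [h0 x]
      rw [h2]
      ring
    have B : ∑ a : Fin 3 × Fin 3, ∑ i, DD i (sS u a.1 a.2) x ^ 2 =
        (1 / 2) * (∑ i, DD i (oS u 0) x ^ 2 + ∑ i, DD i (oS u 1) x ^ 2 + ∑ i, DD i (oS u 2) x ^ 2) +
        ((∑ i, ∑ j, DD i (DD 0 (u j)) x * DD j (DD 0 (u i)) x) +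
        (∑ i, ∑ j, DD i (DD 1 (u j)) x * DD j (DD 1 (u i)) x) +
        (∑ i, ∑ j, DD i (DD 2 (u j)) x * DD j (DD 2 (u i)) x)) := by
      rw [Fintype.sum_prod_type]
      simp [sS, oS, Fin.sum_univ_three]
      simp only [DD_comm 1 0, DD_comm 2 0, DD_comm 2 1]
      ring
    rw [B]
    simp only [hW]
    simp only [Fin.sum_univ_three] at A ⊢
    linear_combination A
  simp only [e]
  have iY : Integrable fun x => (-2 * ν) * (∑ a : Fin 3 × Fin 3, ∑ i, DD i (sS u a.1 a.2) x ^ 2) +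
        (-4) * (Matrix.of fun i j => sS u i j x).det := (iD.const_mul _).add (iX.const_mul _)
  rw [integral_add N.1 iY, N.2, zero_add,
    integral_add (iD.const_mul _) (iX.const_mul _), integral_const_mul, integral_const_mul]

lemma int_F {ι : Type*} [Fintype ι] (f : ι → 𝓢(E3, ℝ)) :
    Integrable fun x => (∑ a, f a x ^ 2) ^ (3 / 2 : ℝ) := by
  set q : E3 → ℝ := fun x => ∑ a, f a x ^ 2 with hq
  have q0 : ∀ x, 0 ≤ q x := fun x => Finset.sum_nonneg fun a _ => sq_nonneg _
  have dq : DecE q := DecE.sum fun a => by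
    simpa [pow_two] using (DecE.schwartz (f a)).mul (DecE.schwartz (f a))
  obtain ⟨K, hK, hqK⟩ := dq.bdd
  have pc : Continuous fun x => q x ^ (1 / 2 : ℝ) := dq.1.rpow_const fun x => Or.inr (by norm_num)
  have pb : ∀ x, |q x ^ (1 / 2 : ℝ)| ≤ K ^ (1 / 2 : ℝ) := fun x => by
    rw [abs_of_nonneg (rpow_nonneg (q0 x) _)]
    exact rpow_le_rpow (q0 x) ((le_abs_self _).trans (hqK x)) (by norm_num)
  have := (dq.mul_bdd pc (by positivity) pb).integrable
  convert this using 2 with x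
  rw [show (3 / 2 : ℝ) = 1 / 2 + 1 by norm_num,
    rpow_add_of_nonneg (q0 x) (by norm_num) zero_le_one, rpow_one]

theorem ens_bound {ν : ℝ} (hν : 0 < ν) (hu : ∑ i, DD i (u i) = 0) {W : Fin 3 → E3 → ℝ}
    (hW : ∀ x k, W k x = ν * (∑ i, DD i (DD i (oS u k)) x) - (∑ i, u i x * DD i (oS u k) x)
      + ∑ j, sS u k j x * oS u j x) :
    ∫ x, ∑ k, oS u k x * W k x ≤ ((1 / 2) * ∫ x, ∑ k, oS u k x ^ 2) ^ 3 / (3456 * π ^ 4 * ν ^ 3) := by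
  have h0 : ∀ x, DD 0 (u 0) x + DD 1 (u 1) x + DD 2 (u 2) x = 0 := fun x => by
    have := congrArg (fun g : 𝓢(E3, ℝ) => g x) hu
    simpa [Fin.sum_univ_three] using this
  rw [← enst_eq hu]
  have g := gn_E3 (fun a : Fin 3 × Fin 3 => sS u a.1 a.2)
  simp only [pd_DD] at g
  set F : E3 → ℝ := fun x => (∑ a : Fin 3 × Fin 3, sS u a.1 a.2 x ^ 2) ^ (3 / 2 : ℝ) with hF
  have q0 : ∀ x, 0 ≤ ∑ a : Fin 3 × Fin 3, sS u a.1 a.2 x ^ 2 := fun x =>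
    Finset.sum_nonneg fun a _ => sq_nonneg _
  have F0 : ∀ x, 0 ≤ F x := fun x => rpow_nonneg (q0 x) _
  have M0 : 0 ≤ ∫ x, F x := integral_nonneg F0
  refine final_alg hν (integral_nonneg q0)
    (integral_nonneg fun x => Finset.sum_nonneg fun a _ => Finset.sum_nonneg fun i _ => sq_nonneg _)
    M0 (spatial hu hW) ?_ g
  have pt : ∀ x, ‖(Matrix.of fun i j => sS u i j x).det‖ ≤ (√54)⁻¹ * F x := fun x => by
    have hd := det_bd (S := Matrix.of fun i j => sS u i j x)
      (by ext i j; simp [sS, add_comm]) (by simp [sS]; linarith [h0 x])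
    have e : (∑ i, ∑ j, (Matrix.of fun i j => sS u i j x) i j ^ 2) ^ 3 = F x ^ 2 := by
      have e1 : ∑ i, ∑ j, (Matrix.of fun i j => sS u i j x) i j ^ 2 =
          ∑ a : Fin 3 × Fin 3, sS u a.1 a.2 x ^ 2 := by
        rw [Fintype.sum_prod_type]; rfl
      rw [e1, hF, ← rpow_natCast _ 2, ← rpow_mul (q0 x), ← rpow_natCast _ 3]
      norm_num
    rw [e] at hd
    rw [Real.norm_eq_abs, ← div_eq_inv_mul, le_div_iff₀ (by positivity)]
    refine abs_le_of_sq_le_sq' ?_ (F0 x) |>.2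
    rw [mul_pow, sq_abs, Real.sq_sqrt (by norm_num)]
    linarith
  have hb := norm_integral_le_of_norm_le ((int_F (fun a : Fin 3 × Fin 3 => sS u a.1 a.2)).const_mul (√54)⁻¹)
    (Filter.Eventually.of_forall pt)
  rw [integral_const_mul] at hb
  change _ ≤ (√54)⁻¹ * ∫ x, F x at hb
  set X := ∫ x, (Matrix.of fun i j => sS u i j x).det
  set M := ∫ x, F x
  have h4 := pow_le_pow_left₀ (norm_nonneg _) hb 4
  have s4 : √54 ^ 4 = 2916 := by
    rw [show √54 ^ 4 = (√54 ^ 2) ^ 2 by ring, Real.sq_sqrt (by norm_num)]; norm_num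
  rw [mul_pow, inv_pow, s4, Real.norm_eq_abs, show |X| ^ 4 = X ^ 4 from Even.pow_abs ⟨2, rfl⟩ X] at h4
  nlinarith

end GN

namespace GN

lemma timeSet_top : timeSet ⊤ = Set.Ici 0 := by
  ext t; simp [timeSet]
lemma timeSet_ne {T : ℝ≥0∞} (h : T ≠ ⊤) : timeSet T = Set.Ico 0 T.toReal := by
  ext t
  simp only [timeSet, Set.mem_ofPred_eq, Set.mem_Ico]
  refine and_congr_right fun ht => ?_
  rw [ENNReal.ofReal_lt_iff_lt_toReal ht h]

lemma timeSet_ud (T : ℝ≥0∞) : UniqueDiffOn ℝ (timeSet T) := by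
  by_cases h : T = ⊤
  · rw [h, timeSet_top]; exact uniqueDiffOn_Ici 0
  · rw [timeSet_ne h]; exact uniqueDiffOn_Ico _ _

lemma timeSet_cl (T : ℝ≥0∞) : timeSet T ⊆ closure (interior (timeSet T)) := by
  by_cases h : T = ⊤
  · rw [h, timeSet_top, interior_Ici, closure_Ioi]
  · rw [timeSet_ne h, interior_Ico]
    intro t ht
    rw [closure_Ioo (ht.1.trans_lt ht.2).ne]
    exact ⟨ht.1, ht.2.le⟩

lemma timeSet_K {T : ℝ≥0∞} {t : ℝ} (ht : t ∈ timeSet T) :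
    ∃ t1, t < t1 ∧ Set.Icc 0 t1 ⊆ timeSet T := by
  obtain ⟨r, h1, h2⟩ := ENNReal.lt_iff_exists_nnreal_btwn.1 ht.2
  refine ⟨r, ?_, fun s hs => ⟨hs.1, lt_of_le_of_lt ?_ h2⟩⟩
  · rw [ENNReal.ofReal_lt_iff_lt_toReal ht.1 (by simp)] at h1; simpa using h1
  · exact ENNReal.ofReal_le_of_le_toReal (by simpa using hs.2)

variable {ν : ℝ} {T : ℝ≥0∞}

lemma mixed (sol : AdmissibleSolution ν T) {t : ℝ} (ht : t ∈ timeSet T) (i j : Fin 3) (x : E3) :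
    HasDerivWithinAt (fun s => DD i (sol.u s j) x) (DD i (sol.u' t j) x) (timeSet T) t := by
  set Z : Set (ℝ × E3) := timeSet T ×ˢ Set.univ with hZ
  set F : ℝ × E3 → ℝ := fun p => sol.u p.1 j p.2 with hFd
  have hsm : ContDiffOn ℝ (⊤ : ℕ∞) F Z := sol.smooth j
  have hud : UniqueDiffOn ℝ Z := (timeSet_ud T).prod uniqueDiffOn_univ
  set G := fderivWithin ℝ F Z with hGd
  set H := fderivWithin ℝ G Z with hHd
  have hF : ∀ p ∈ Z, HasFDerivWithinAt F (G p) Z p := fun p hp =>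
    ((hsm p hp).differentiableWithinAt (by simp)).hasFDerivWithinAt
  have hGs : ContDiffOn ℝ 1 G Z := hsm.fderivWithin hud (by norm_cast)
  have hG : ∀ p ∈ Z, HasFDerivWithinAt G (H p) Z p := fun p hp =>
    ((hGs p hp).differentiableWithinAt (by simp)).hasFDerivWithinAt
  have mem : ∀ s ∈ timeSet T, ∀ y : E3, (s, y) ∈ Z := fun s hs y => ⟨hs, trivial⟩
  have line : ∀ (s : ℝ) (y e : E3), HasDerivAt (fun r : ℝ => (s, y + r • e)) ((0 : ℝ), e) 0 :=
    fun s y e => by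
      have := ((hasDerivAt_id (0:ℝ)).smul_const e).const_add y
      simpa using (hasDerivAt_const (0:ℝ) s).prodMk this
  have tline : ∀ (s : ℝ) (y : E3), HasDerivWithinAt (fun r : ℝ => (r, y)) ((1 : ℝ), (0 : E3)) (timeSet T) s :=
    fun s y => ((hasDerivAt_id s).prodMk (hasDerivAt_const s y)).hasDerivWithinAt
  have sline : ∀ (f : 𝓢(E3, ℝ)) (y : E3), HasDerivAt (fun r : ℝ => f (y + r • ee i)) (DD i f y) 0 :=
    fun f y => by
      have h1 := ((hasDerivAt_id (0:ℝ)).smul_const (ee i)).const_add y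
      have h2 : HasFDerivAt f (fderiv ℝ f (y + (0:ℝ) • ee i)) (y + (0:ℝ) • ee i) := f.differentiableAt.hasFDerivAt
      have := h2.comp_hasDerivAt (0:ℝ) h1
      simpa [DD_apply, Function.comp_def] using this
  have key : ∀ {V : Type} [NormedAddCommGroup V] [NormedSpace ℝ V] (A : ℝ × E3 → V) (A' : ℝ × E3 →L[ℝ] V)
      (s : ℝ) (y : E3), s ∈ timeSet T → HasFDerivWithinAt A A' Z (s, y) →
      HasDerivAt (fun r : ℝ => A (s, y + r • ee i)) (A' (0, ee i)) 0 := fun A A' s y hs h => by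
    have h' : HasFDerivWithinAt A A' Z (s, y + (0:ℝ) • ee i) := by simpa using h
    have := h'.comp_hasDerivWithinAt (s := Set.univ) (0:ℝ) (line s y (ee i)).hasDerivWithinAt
      (fun r _ => mem s hs _)
    exact this.hasDerivAt Filter.univ_mem
  have a : ∀ s ∈ timeSet T, DD i (sol.u s j) x = G (s, x) (0, ee i) := fun s hs =>
    (sline (sol.u s j) x).unique (key F _ s x hs (hF _ (mem s hs x)))
  have b : ∀ s ∈ timeSet T, ∀ y, sol.u' s j y = G (s, y) (1, 0) := fun s hs y => by
    have h := (hF _ (mem s hs y)).comp_hasDerivWithinAt s (tline s y) (fun r hr => mem r hr y)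
    exact (timeSet_ud T s hs).eq_deriv _ (sol.tderiv s hs j y) h
  have c : HasDerivWithinAt (fun s => G (s, x) (0, ee i)) (H (t, x) (1, 0) (0, ee i)) (timeSet T) t := by
    have h := (hG _ (mem t ht x)).comp_hasDerivWithinAt t (tline t x) (fun r hr => mem r hr x)
    simpa using h.clm_apply (hasDerivWithinAt_const t (timeSet T) ((0:ℝ), ee i))
  have d : DD i (sol.u' t j) x = H (t, x) (0, ee i) (1, 0) := by
    refine (sline (sol.u' t j) x).unique ?_
    have h := key G _ t x ht (hG _ (mem t ht x))
    have h2 := h.clm_apply (hasDerivAt_const (0:ℝ) ((1:ℝ), (0:E3)))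
    simp only [b t ht]
    simpa using h2
  have sy : IsSymmSndFDerivWithinAt ℝ F Z (t, x) :=
    (hsm _ (mem t ht x)).isSymmSndFDerivWithinAt (by simp; norm_cast) hud
      (by
        rw [hZ, interior_prod_eq, closure_prod_eq]
        exact ⟨timeSet_cl T ht, by simp⟩) (mem t ht x)
  rw [d, sy.eq]
  exact c.congr a (a t ht)

def ww (x : E3) : ℝ := rr (x 0) * rr (x 1) * rr (x 2)

lemma ww_pos (x : E3) : 0 < ww x := mul_pos (mul_pos (rr_pos _) (rr_pos _)) (rr_pos _)
lemma ww_le (x : E3) : ww x ≤ 1 :=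
  mul_le_one₀ (mul_le_one₀ (rr_le_one _) (rr_pos _).le (rr_le_one _)) (rr_pos _).le (rr_le_one _)
lemma ww_int : Integrable ww := by
  refine DecE.integrable ⟨?_, 1, zero_le_one, fun x => ?_⟩
  · have h := rr_cont
    unfold ww
    fun_prop
  · rw [one_mul]; exact (abs_of_pos (ww_pos x)).le

lemma ww_bd {a C D : ℝ} {x : E3} (h1 : |a| ≤ C) (h2 : ‖x‖ ^ 6 * |a| ≤ D) :
    |a| ≤ 4 * (C + D) * ww x := by
  have hn : ‖x‖ ^ 2 = x 0 ^ 2 + x 1 ^ 2 + x 2 ^ 2 := by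
    rw [EuclideanSpace.real_norm_sq_eq, Fin.sum_univ_three]
  have hw : ww x = ((1 + x 0 ^ 2) * (1 + x 1 ^ 2) * (1 + x 2 ^ 2))⁻¹ := by
    unfold ww rr; rw [mul_inv, mul_inv]
  rw [hw, ← div_eq_mul_inv, le_div_iff₀ (by positivity)]
  have hb : (1 + x 0 ^ 2) * (1 + x 1 ^ 2) * (1 + x 2 ^ 2) ≤ 4 * (1 + ‖x‖ ^ 6) := by
    have e : (1 + x 0 ^ 2) * (1 + x 1 ^ 2) * (1 + x 2 ^ 2) ≤ (1 + ‖x‖ ^ 2) ^ 3 := by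
      have a0 : 1 + x 0 ^ 2 ≤ 1 + ‖x‖ ^ 2 := by nlinarith [sq_nonneg (x 1), sq_nonneg (x 2)]
      have a1 : 1 + x 1 ^ 2 ≤ 1 + ‖x‖ ^ 2 := by nlinarith [sq_nonneg (x 0), sq_nonneg (x 2)]
      have a2 : 1 + x 2 ^ 2 ≤ 1 + ‖x‖ ^ 2 := by nlinarith [sq_nonneg (x 0), sq_nonneg (x 1)]
      calc _ ≤ (1 + ‖x‖ ^ 2) * (1 + ‖x‖ ^ 2) * (1 + ‖x‖ ^ 2) := by gcongr
        _ = _ := by ring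
    refine e.trans ?_
    have : 0 ≤ ‖x‖ ^ 2 := by positivity
    have h6 : ‖x‖ ^ 6 = (‖x‖ ^ 2) ^ 3 := by ring
    rw [h6]
    nlinarith [mul_nonneg (sq_nonneg (1 - ‖x‖ ^ 2)) (by positivity : 0 ≤ 1 + ‖x‖ ^ 2)]
  calc |a| * _ ≤ |a| * (4 * (1 + ‖x‖ ^ 6)) := by gcongr
    _ = 4 * (|a| + ‖x‖ ^ 6 * |a|) := by ring
    _ ≤ _ := by linarith

lemma DD_bd (f : 𝓢(E3, ℝ)) (i : Fin 3) (x : E3) :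
    |DD i f x| ≤ 4 * (SchwartzMap.seminorm ℝ 0 1 f + SchwartzMap.seminorm ℝ 6 1 f) * ww x := by
  have h : |DD i f x| ≤ ‖iteratedFDeriv ℝ 1 f x‖ := by
    rw [DD_apply, norm_iteratedFDeriv_one, ← Real.norm_eq_abs]
    refine (ContinuousLinearMap.le_opNorm _ _).trans ?_
    simp [ee]
  have h0 := SchwartzMap.le_seminorm ℝ 0 1 f x
  have h6 := SchwartzMap.le_seminorm ℝ 6 1 f x
  refine ww_bd ?_ ?_
  · refine h.trans ?_; simpa using h0
  · refine le_trans ?_ h6; gcongr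

lemma unif (sol : AdmissibleSolution ν T) {K : Set ℝ} (hK : IsCompact K) (hs : K ⊆ timeSet T) :
    ∃ C, 0 ≤ C ∧ ∀ t ∈ K, ∀ k x, |oS (sol.u t) k x| ≤ C * ww x ∧ |oS (sol.u' t) k x| ≤ C * ww x := by
  choose A hA using fun i => sol.seminorm_bdd K hK hs 0 1 i
  choose B hB using fun i => sol.seminorm_bdd K hK hs 6 1 i
  set C := ∑ i, (|A i| + |B i|) with hC
  have C0 : ∀ i, A i + B i ≤ C := fun i =>
    (add_le_add (le_abs_self _) (le_abs_self _)).trans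
      (Finset.single_le_sum (f := fun i => |A i| + |B i|) (fun i _ => by positivity) (Finset.mem_univ i))
  have hC0 : 0 ≤ C := Finset.sum_nonneg fun i _ => by positivity
  refine ⟨8 * C, by positivity, fun t ht k x => ?_⟩
  have b1 : ∀ i j, |DD i (sol.u t j) x| ≤ 4 * C * ww x := fun i j => by
    refine (DD_bd _ i x).trans ?_
    have := (ww_pos x).le
    gcongr
    linarith [(hA j t ht).1, (hB j t ht).1, C0 j]
  have b2 : ∀ i j, |DD i (sol.u' t j) x| ≤ 4 * C * ww x := fun i j => by
    refine (DD_bd _ i x).trans ?_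
    have := (ww_pos x).le
    gcongr
    linarith [(hA j t ht).2, (hB j t ht).2, C0 j]
  have gen : ∀ (v : Fin 3 → 𝓢(E3, ℝ)), (∀ i j, |DD i (v j) x| ≤ 4 * C * ww x) → |oS v k x| ≤ 8 * C * ww x := by
    intro v hv
    have sb : ∀ a b c d, |DD a (v b) x - DD c (v d) x| ≤ 8 * C * ww x := fun a b c d => by
      refine (abs_sub _ _).trans ?_
      linarith [hv a b, hv c d]
    fin_cases k <;> simpa [oS] using sb _ _ _ _
  exact ⟨gen _ b1, gen _ b2⟩

lemma oS_deriv (sol : AdmissibleSolution ν T) {t : ℝ} (ht : t ∈ timeSet T) (k : Fin 3) (x : E3) :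
    HasDerivWithinAt (fun s => oS (sol.u s) k x) (oS (sol.u' t) k x) (timeSet T) t := by
  fin_cases k
  · exact (mixed sol ht 1 2 x).fun_sub (mixed sol ht 2 1 x)
  · exact (mixed sol ht 2 0 x).fun_sub (mixed sol ht 0 2 x)
  · exact (mixed sol ht 0 1 x).fun_sub (mixed sol ht 1 0 x)

lemma int_deriv {g g' : ℝ → E3 → ℝ} {B : E3 → ℝ} {t t1 : ℝ} (ht : t ∈ timeSet T) (h1 : t < t1)
    (hK : Set.Icc 0 t1 ⊆ timeSet T)
    (hg : ∀ s ∈ timeSet T, ∀ x, HasDerivWithinAt (fun s => g s x) (g' s x) (timeSet T) s)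
    (hb : ∀ s ∈ Set.Icc 0 t1, ∀ x, |g' s x| ≤ B x) (hB : Integrable B) (hi : ∀ s, Integrable (g s)) :
    HasDerivWithinAt (fun s => ∫ x, g s x) (∫ x, g' t x) (timeSet T) t := by
  rw [hasDerivWithinAt_iff_tendsto_slope]
  have htK : t ∈ Set.Icc 0 t1 := ⟨ht.1, h1.le⟩
  have ev : ∀ᶠ s in nhdsWithin t (timeSet T \ {t}), s ∈ Set.Icc 0 t1 ∧ s ≠ t := by
    filter_upwards [self_mem_nhdsWithin, nhdsWithin_le_nhds (Iio_mem_nhds h1)] with s hs hs1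
    exact ⟨⟨hs.1.1, le_of_lt hs1⟩, hs.2⟩
  have e : ∀ s, slope (fun s => ∫ x, g s x) t s = ∫ x, slope (fun s => g s x) t s := fun s => by
    simp only [slope_def_field]
    rw [integral_div, integral_sub (hi s) (hi t)]
  simp only [funext e]
  refine tendsto_integral_filter_of_dominated_convergence B ?_ ?_ hB ?_
  · refine Filter.Eventually.of_forall fun s => ?_
    simp only [slope_def_field]
    exact (((hi s).sub (hi t)).div_const _).aestronglyMeasurable
  · filter_upwards [ev] with s hs
    refine Filter.Eventually.of_forall fun x => ?_
    have := Convex.norm_image_sub_le_of_norm_hasDerivWithin_le (f := fun s => g s x) (f' := fun s => g' s x)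
      (fun r hr => (hg r (hK hr) x).mono hK) (fun r hr => hb r hr x) (convex_Icc 0 t1) htK hs.1
    rw [slope_def_field, norm_div, div_le_iff₀ (norm_pos_iff.2 (sub_ne_zero.2 hs.2))]
    exact this
  · exact Filter.Eventually.of_forall fun x => hasDerivWithinAt_iff_tendsto_slope.1 (hg t ht x)

lemma enst_deriv (sol : AdmissibleSolution ν T) {t : ℝ} (ht : t ∈ timeSet T) :
    HasDerivWithinAt sol.enstrophy (∫ x, ∑ k, oS (sol.u t) k x * oS (sol.u' t) k x) (timeSet T) t := by
  obtain ⟨t1, h1, hK⟩ := timeSet_K ht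
  obtain ⟨C, hC, hb⟩ := unif sol isCompact_Icc hK
  have h := int_deriv (g := fun s x => ∑ k, oS (sol.u s) k x ^ 2)
    (g' := fun s x => 2 * ∑ k, oS (sol.u s) k x * oS (sol.u' s) k x)
    (B := fun x => 6 * C ^ 2 * ww x) ht h1 hK
    (fun s hs x => by
      rw [Finset.mul_sum]
      refine HasDerivWithinAt.fun_sum fun k _ => ?_
      refine ((oS_deriv sol hs k x).pow 2).congr_deriv ?_
      simp; ring)
    (fun s hs x => by
      have w0 := (ww_pos x).le
      have w1 := ww_le x
      have p : ∀ k, |oS (sol.u s) k x * oS (sol.u' s) k x| ≤ C ^ 2 * ww x := fun k => by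
        rw [abs_mul]
        have := mul_le_mul (hb s hs k x).1 (hb s hs k x).2 (abs_nonneg _) (by positivity)
        refine this.trans ?_
        have : C ^ 2 * ww x * ww x ≤ C ^ 2 * ww x * 1 := by gcongr
        linarith
      rw [abs_mul, abs_two]
      have := Finset.abs_sum_le_sum_abs (fun k => oS (sol.u s) k x * oS (sol.u' s) k x) Finset.univ
      have h3 := this.trans (Finset.sum_le_sum fun k _ => p k)
      simp at h3
      linarith)
    (ww_int.const_mul _)
    (fun s => (DecE.sum fun k => by
      simpa [pow_two] using (DecE.schwartz (oS (sol.u s) k)).mul (DecE.schwartz (oS (sol.u s) k))).integrable)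
  have h2 := h.const_mul (1 / 2 : ℝ)
  rw [integral_const_mul, ← mul_assoc] at h2
  norm_num at h2
  have e : sol.enstrophy = fun s => 1 / 2 * ∫ x, ∑ k, oS (sol.u s) k x ^ 2 := by
    funext s; simp only [AdmissibleSolution.enstrophy, AdmissibleSolution.vort, curl_eq]
  rw [e]
  norm_num
  exact h2

theorem enst_main (ν : ℝ) (hν : 0 < ν) (T : ℝ≥0∞) (sol : AdmissibleSolution ν T) :
    ∀ t ∈ timeSet T, ∃ d : ℝ,
      HasDerivWithinAt sol.enstrophy d (timeSet T) t ∧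
      d ≤ (sol.enstrophy t) ^ 3 / (3456 * π ^ 4 * ν ^ 3) := by
  intro t ht
  refine ⟨_, enst_deriv sol ht, ?_⟩
  have e : sol.enstrophy t = 1 / 2 * ∫ x, ∑ k, oS (sol.u t) k x ^ 2 := by
    simp only [AdmissibleSolution.enstrophy, AdmissibleSolution.vort, curl_eq]
  rw [e]
  refine ens_bound hν ?_ (W := fun k x => oS (sol.u' t) k x) ?_
  · ext x
    have := sol.divfree t ht x
    simpa [pd_DD, Fin.sum_univ_three] using this
  · intro x k
    have h := sol.vort_eq t ht x k
    simp only [curl_eq, strain_eq, pd_DD] at h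
    rw [(oS_deriv sol ht k x).derivWithin (timeSet_ud T t ht)] at h
    linarith

end GN

/-- For an admissible solution of the vorticity equation on `[0,T)` with viscosity
`ν > 0`, the enstrophy `E(t)` is differentiable on `[0,T)` with
`E'(t) ≤ E(t)³/(3456 π⁴ ν³)`. -/
theorem statement6 (ν : ℝ) (hν : 0 < ν) (T : ℝ≥0∞) (hT : 0 < T)
    (sol : AdmissibleSolution ν T) :
    ∀ t ∈ timeSet T, ∃ d : ℝ,
      HasDerivWithinAt sol.enstrophy d (timeSet T) t ∧
      d ≤ (sol.enstrophy t) ^ 3 / (3456 * π ^ 4 * ν ^ 3) := by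
  exact GN.enst_main ν hν T sol
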